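/- arXiv:1404.7612 — 2 statements merged into one kernel-verified Lean document; each statement's English description precedes it below -/
import Mathlib

section
/- Let 1<α<2 and ω>0. There exists a constant C>0 such that for all t≥1, |E_α(i^α ω^α t^α) − (1/α) e^{iωt}| ≤ C t^{−α}. -/
open MeasureTheory Filter Set

/-- The Mittag-Leffler function `E_{a,b}(z) = ∑ z^k / Γ(a k + b)`, where `1/Γ` is the
entire reciprocal Gamma function (Mathlib's `Real.Gamma` vanishes at the poles). -/
noncomputable def mittagLeffler (a b : ℝ) (z : ℂ) : ℂ :=
  ∑' k : ℕ, z ^ k / (Real.Gamma (a * k + b) : ℂ)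

theorem integrableOn_rpow_mul_cexp_neg_mul {a : ℝ} (ha : 0 < a) {s : ℂ} (hs : 0 < s.re) :
    IntegrableOn (fun t : ℝ => ((t ^ a : ℝ) : ℂ) * Complex.exp (-(s * t))) (Ioi 0) := by
  have h := integrableOn_rpow_mul_exp_neg_mul_rpow (p := 1) (s := a) (by linarith) one_pos hs
  refine (integrable_norm_iff ?_).1 (h.congr_fun ?_ measurableSet_Ioi)
  · apply Measurable.aestronglyMeasurable
    fun_prop
  · intro t ht
    simp [Complex.norm_exp, abs_of_nonneg (Real.rpow_nonneg (le_of_lt ht) a)]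

theorem integral_rpow_mul_cexp_neg_mul {a : ℝ} (ha : 0 < a) {s : ℂ} (hs : 0 < s.re) :
    ∫ t in Ioi (0 : ℝ), ((t ^ a : ℝ) : ℂ) * Complex.exp (-(s * t))
      = Real.Gamma (a + 1) * s ^ (-(a + 1) : ℂ) := by
  set μ : Measure ℝ := (volume.restrict (Ioi 0)).withDensity (fun t => ↑(t ^ a).toNNReal) with hμ
  have hmeas : Measurable (fun t : ℝ => (t ^ a).toNNReal) := by fun_prop
  have key (z : ℂ) : ProbabilityTheory.complexMGF id μ z =
      ∫ t in Ioi (0 : ℝ), ((t ^ a : ℝ) : ℂ) * Complex.exp (z * t) := by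
    rw [ProbabilityTheory.complexMGF, hμ, integral_withDensity_eq_integral_smul hmeas]
    refine setIntegral_congr_fun measurableSet_Ioi fun t ht => ?_
    simp [NNReal.smul_def, Real.coe_toNNReal _ (Real.rpow_nonneg (le_of_lt ht) a)]
  have hsub : Iio 0 ⊆ interior (ProbabilityTheory.integrableExpSet id μ) := by
    refine interior_maximal (fun x hx => ?_) isOpen_Iio
    rw [ProbabilityTheory.integrableExpSet, mem_ofPred_eq, hμ,
      integrable_withDensity_iff_integrable_smul hmeas]
    have h := integrableOn_rpow_mul_exp_neg_mul_rpow (p := 1) (s := a) (b := -x)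
      (by linarith) one_pos (by simpa using hx)
    refine h.congr_fun (fun t ht => ?_) measurableSet_Ioi
    simp [NNReal.smul_def, Real.coe_toNNReal _ (Real.rpow_nonneg (le_of_lt ht) a)]
  have hopen : IsOpen {z : ℂ | z.re < 0} := isOpen_lt Complex.continuous_re continuous_const
  have h1 : AnalyticOnNhd ℂ (ProbabilityTheory.complexMGF id μ) {z : ℂ | z.re < 0} :=
    ProbabilityTheory.analyticOnNhd_complexMGF.mono fun z hz => hsub hz
  have h2 : AnalyticOnNhd ℂ (fun z : ℂ => Real.Gamma (a + 1) * (-z) ^ (-(a + 1) : ℂ))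
      {z : ℂ | z.re < 0} := by
    refine DifferentiableOn.analyticOnNhd (fun z hz => ?_) hopen
    refine DifferentiableAt.differentiableWithinAt ?_
    refine (DifferentiableAt.cpow (by fun_prop) (by fun_prop) ?_).const_mul _
    left; simpa using hz
  have hreal (x : ℝ) (hx : x < 0) : ProbabilityTheory.complexMGF id μ x =
      Real.Gamma (a + 1) * (-(x : ℂ)) ^ (-(a + 1) : ℂ) := by
    have h := Complex.integral_cpow_mul_exp_neg_mul_Ioi (a := a + 1) (r := -x)
      (by simp; linarith) (by linarith)
    rw [key, ← Complex.Gamma_ofReal, mul_comm]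
    push_cast at h ⊢
    rw [Complex.cpow_neg, ← Complex.inv_cpow, ← one_div, ← h]
    · refine setIntegral_congr_fun measurableSet_Ioi fun t ht => ?_
      simp [Complex.ofReal_cpow (le_of_lt ht)]
    · rw [← Complex.ofReal_neg, Complex.arg_ofReal_of_nonneg (by linarith)]
      exact Real.pi_pos.ne
  have hfreq : ∃ᶠ z in nhdsWithin (-1 : ℂ) {-1}ᶜ, ProbabilityTheory.complexMGF id μ z =
      Real.Gamma (a + 1) * (-z) ^ (-(a + 1) : ℂ) := by
    have hlim : Tendsto (fun x : ℝ => (x : ℂ)) (nhdsWithin (-1) {-1}ᶜ)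
        (nhdsWithin (-1 : ℂ) {-1}ᶜ) := by
      refine tendsto_nhdsWithin_iff.2 ⟨?_, ?_⟩
      · have := (Complex.continuous_ofReal.tendsto (-1)).mono_left
          (nhdsWithin_le_nhds (s := {(-1 : ℝ)}ᶜ))
        simpa using this
      · filter_upwards [self_mem_nhdsWithin] with x hx
        simpa using fun h => hx (by exact_mod_cast h)
    refine hlim.frequently (Eventually.frequently ?_)
    filter_upwards [mem_nhdsWithin_of_mem_nhds (Iio_mem_nhds (by norm_num : (-1 : ℝ) < 0))]
      with x hx using hreal x hx
  have := h1.eqOn_of_preconnected_of_frequently_eq h2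
    (convex_halfSpace_re_lt 0).isPreconnected (by simp) hfreq (show -s ∈ {z : ℂ | z.re < 0} by simpa using hs)
  simpa [key] using this

theorem abs_le_norm_add_mul_I {σ ξ : ℝ} : |ξ| ≤ ‖(σ + ξ * Complex.I : ℂ)‖ := by
  simpa using Complex.abs_im_le_norm (σ + ξ * Complex.I)

theorem le_norm_add_mul_I {σ ξ : ℝ} : σ ≤ ‖(σ + ξ * Complex.I : ℂ)‖ := by
  simpa using Complex.re_le_norm (σ + ξ * Complex.I)

theorem continuous_norm_add_mul_I_rpow {σ : ℝ} (hσ : 0 < σ) (p : ℝ) :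
    Continuous fun ξ : ℝ => ‖(σ + ξ * Complex.I : ℂ)‖ ^ p := by
  refine Continuous.rpow_const (by fun_prop) fun ξ => Or.inl ?_
  exact (hσ.trans_le le_norm_add_mul_I).ne'

theorem integrable_norm_add_mul_I_rpow {σ p : ℝ} (hσ : 0 < σ) (hp : 1 < p) :
    Integrable fun ξ : ℝ => ‖(σ + ξ * Complex.I : ℂ)‖ ^ (-p) := by
  have h := (integrable_one_add_norm (E := ℝ) (μ := volume) (r := p) (by simpa using hp)).const_mul
    ((1 + 1 / σ) ^ p)
  refine h.mono' (continuous_norm_add_mul_I_rpow hσ _).aestronglyMeasurable (.of_forall fun ξ => ?_)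
  have hpos : 0 < ‖(σ + ξ * Complex.I : ℂ)‖ := hσ.trans_le le_norm_add_mul_I
  rw [Real.norm_of_nonneg (by positivity), Real.rpow_neg hpos.le, Real.rpow_neg (by positivity),
    ← div_eq_mul_inv, ← Real.div_rpow (by positivity) (by positivity),
    ← Real.inv_rpow hpos.le]
  refine Real.rpow_le_rpow (by positivity) ?_ (by linarith)
  rw [inv_eq_one_div, div_le_div_iff₀ hpos (by positivity), Real.norm_eq_abs]
  have h1 := abs_le_norm_add_mul_I (σ := σ) (ξ := ξ)
  have h2 : 1 ≤ 1 / σ * ‖(σ + ξ * Complex.I : ℂ)‖ := by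
    rw [one_div, inv_mul_eq_div, one_le_div hσ]; exact le_norm_add_mul_I
  linarith

/-- Inverse Laplace transform of a power. -/
theorem integral_cexp_mul_cpow_vertical {a σ x : ℝ} (ha : 0 < a) (hσ : 0 < σ) (hx : 0 < x) :
    ∫ ξ : ℝ, Complex.exp ((σ + ξ * Complex.I) * x) * (σ + ξ * Complex.I) ^ (-(a + 1) : ℂ)
      = 2 * Real.pi * ((x ^ a : ℝ) / (Real.Gamma (a + 1) : ℂ)) := by
  set f : ℝ → ℂ := (Ioi 0).indicator fun t : ℝ => ((t ^ a : ℝ) : ℂ) * Complex.exp (-((σ : ℂ) * t))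
    with hf
  have hfi : Integrable f := (integrable_indicator_iff measurableSet_Ioi).2
    (integrableOn_rpow_mul_cexp_neg_mul ha (by simpa using hσ))
  have hF (w : ℝ) : FourierTransform.fourier f w =
      Real.Gamma (a + 1) * (σ + (2 * Real.pi * w : ℝ) * Complex.I) ^ (-(a + 1) : ℂ) := by
    rw [Real.fourier_real_eq_integral_exp_smul, ← integral_rpow_mul_cexp_neg_mul ha (by simpa using hσ),
      ← integral_indicator measurableSet_Ioi]
    refine integral_congr_ae (.of_forall fun t => ?_)
    by_cases ht : t ∈ Ioi (0 : ℝ)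
    · simp only [hf, indicator_of_mem ht, smul_eq_mul]
      rw [mul_left_comm, ← Complex.exp_add]
      congr 2
      push_cast; ring
    · simp only [hf, indicator_of_notMem ht, smul_zero]
  have hΓ : (0 : ℝ) < Real.Gamma (a + 1) := Real.Gamma_pos_of_pos (by linarith)
  have hFi : Integrable (FourierTransform.fourier f) := by
    have hc := integrable_norm_add_mul_I_rpow hσ (show 1 < a + 1 by linarith)
    have hc2 := (hc.comp_mul_left' (R := 2 * Real.pi) (by positivity)).const_mul (Real.Gamma (a + 1))
    refine hc2.mono' ?_ (.of_forall fun w => ?_)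
    · rw [funext hF]
      apply Measurable.aestronglyMeasurable
      fun_prop
    · rw [hF]
      have := Complex.norm_cpow_real (σ + (2 * Real.pi * w : ℝ) * Complex.I) (-(a + 1))
      push_cast at this ⊢
      rw [norm_mul, this, Complex.norm_real, Real.norm_of_nonneg hΓ.le]
  have hcont : ContinuousAt f x := by
    have hg : ContinuousAt (fun t : ℝ => ((t ^ a : ℝ) : ℂ) * Complex.exp (-((σ : ℂ) * t))) x := by
      refine ContinuousAt.mul ?_ (by fun_prop)
      exact Complex.continuous_ofReal.continuousAt.comp (Real.continuousAt_rpow_const _ _ (.inl hx.ne'))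
    refine hg.congr ?_
    filter_upwards [Ioi_mem_nhds hx] with t ht
    simp [hf, indicator_of_mem ht]
  have hinv := hfi.fourierInv_fourier_eq hFi hcont
  rw [Real.fourierInv_eq'] at hinv
  have hcv := Measure.integral_comp_mul_left (fun ξ : ℝ => Complex.exp ((σ + ξ * Complex.I) * x)
    * (σ + ξ * Complex.I) ^ (-(a + 1) : ℂ)) (2 * Real.pi)
  rw [abs_of_pos (by positivity), eq_inv_smul_iff₀ (by positivity)] at hcv
  rw [← hcv, Complex.real_smul]
  push_cast
  congr 1
  have hfx : ((x ^ a : ℝ) : ℂ) = f x * Complex.exp (σ * x) := by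
    simp only [hf, indicator_of_mem (show x ∈ Ioi 0 from hx)]
    rw [mul_assoc, ← Complex.exp_add, neg_add_cancel, Complex.exp_zero, mul_one]
  rw [eq_div_iff (by exact_mod_cast hΓ.ne'), hfx, ← hinv, ← integral_mul_const, ← integral_mul_const]
  refine integral_congr_ae (.of_forall fun w => ?_)
  simp only [hF, smul_eq_mul]
  rw [show Complex.exp ((σ + 2 * Real.pi * w * Complex.I) * x) =
    Complex.exp (↑(2 * Real.pi * inner ℝ w x) * Complex.I) * Complex.exp (σ * x) by
      rw [← Complex.exp_add]; congr 1; simp; ring]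
  push_cast
  ring

theorem integrable_cexp_mul_vertical {F : ℂ → ℂ} (hF : ContinuousOn F {s | 0 < s.re})
    {C p : ℝ} (hp : 1 < p) (hb : ∀ s : ℂ, 0 < s.re → ‖F s‖ ≤ C * ‖s‖ ^ (-p))
    {σ : ℝ} (hσ : 0 < σ) (x : ℝ) :
    Integrable fun ξ : ℝ => Complex.exp ((σ + ξ * Complex.I) * x) * F (σ + ξ * Complex.I) := by
  refine (((integrable_norm_add_mul_I_rpow hσ hp).const_mul C).const_mul
    (Real.exp (σ * x))).mono' ?_ (.of_forall fun ξ => ?_)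
  · refine Continuous.aestronglyMeasurable (Continuous.mul (by fun_prop) ?_)
    exact hF.comp_continuous (by fun_prop) fun ξ => by simpa using hσ
  · rw [norm_mul, Complex.norm_exp]
    have := hb (σ + ξ * Complex.I) (by simpa using hσ)
    simpa using mul_le_mul_of_nonneg_left this (Real.exp_pos (σ * x)).le

/-- The inverse Laplace integral does not depend on the abscissa. -/
theorem integral_cexp_mul_vertical_eq {F : ℂ → ℂ} (hF : DifferentiableOn ℂ F {s | 0 < s.re})
    {C p : ℝ} (hp : 1 < p) (hb : ∀ s : ℂ, 0 < s.re → ‖F s‖ ≤ C * ‖s‖ ^ (-p))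
    {σ₁ σ₂ : ℝ} (hσ₁ : 0 < σ₁) (hσ₂ : 0 < σ₂) {x : ℝ} (hx : 0 < x) :
    ∫ ξ : ℝ, Complex.exp ((σ₁ + ξ * Complex.I) * x) * F (σ₁ + ξ * Complex.I)
      = ∫ ξ : ℝ, Complex.exp ((σ₂ + ξ * Complex.I) * x) * F (σ₂ + ξ * Complex.I) := by
  set G : ℂ → ℂ := fun s => Complex.exp (s * x) * F s with hG
  have hC : 0 ≤ C := by simpa using (norm_nonneg _).trans (hb 1 (by simp))
  have hmin : ∀ y ∈ uIcc σ₁ σ₂, 0 < y := fun y hy => (lt_min hσ₁ hσ₂).trans_le hy.1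
  have hmax : ∀ y ∈ uIcc σ₁ σ₂, y ≤ max σ₁ σ₂ := fun y hy => hy.2
  have hGd : DifferentiableOn ℂ G {s | 0 < s.re} := by
    refine DifferentiableOn.mul ?_ hF
    exact Differentiable.differentiableOn (by fun_prop)
  have hrect (T : ℝ) := Complex.integral_boundary_rect_eq_zero_of_differentiableOn G
    (σ₁ + (-T : ℝ) * Complex.I) (σ₂ + T * Complex.I) (hGd.mono fun s hs => by
      have := hs.1; simp at this; exact hmin _ this)
  have hlim (σ : ℝ) (hσ : 0 < σ) : Tendsto (fun T : ℝ => ∫ y in (-T)..T, G (σ + y * Complex.I)) atTop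
      (nhds (∫ y : ℝ, G (σ + y * Complex.I))) :=
    intervalIntegral_tendsto_integral (integrable_cexp_mul_vertical hF.continuousOn hp hb hσ x)
      tendsto_neg_atTop_atBot tendsto_id
  have hhor (ε : ℝ) (hε : |ε| = 1) : Tendsto
      (fun T : ℝ => ∫ y in σ₁..σ₂, G (y + (ε * T : ℝ) * Complex.I)) atTop (nhds 0) := by
    have h0 : Tendsto (fun T : ℝ => Real.exp (max σ₁ σ₂ * x) * (C * T ^ (-p)) * |σ₂ - σ₁|)
        atTop (nhds 0) := by
      have := tendsto_rpow_neg_atTop (show 0 < p by linarith)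
      simpa using ((this.const_mul C).const_mul (Real.exp (max σ₁ σ₂ * x))).mul_const |σ₂ - σ₁|
    refine squeeze_zero_norm' ?_ h0
    filter_upwards [eventually_gt_atTop 0] with T hT
    refine intervalIntegral.norm_integral_le_of_norm_le_const fun y hy => ?_
    have hy' := uIoc_subset_uIcc hy
    have hTn : T ≤ ‖(y + (ε * T : ℝ) * Complex.I : ℂ)‖ := by
      refine le_trans ?_ abs_le_norm_add_mul_I
      rw [abs_mul, hε, one_mul, abs_of_pos hT]
    rw [hG]
    simp only [norm_mul, Complex.norm_exp]
    refine mul_le_mul ?_ ((hb _ ?_).trans ?_) (norm_nonneg _) (Real.exp_pos _).le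
    · simpa using mul_le_mul_of_nonneg_right (hmax _ hy') hx.le
    · simpa using hmin _ hy'
    · exact mul_le_mul_of_nonneg_left
        (Real.rpow_le_rpow_of_nonpos hT hTn (by linarith)) hC
  have htot := (((hhor (-1) (by simp)).sub (hhor 1 (by simp))).add
    ((hlim σ₂ hσ₂).const_smul Complex.I)).sub ((hlim σ₁ hσ₁).const_smul Complex.I)
  have h0 : Complex.I • (∫ y : ℝ, G (σ₂ + y * Complex.I))
      - Complex.I • (∫ y : ℝ, G (σ₁ + y * Complex.I)) = 0 := by
    refine tendsto_nhds_unique (f := fun _ : ℝ => (0 : ℂ)) (l := atTop) ?_ tendsto_const_nhds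
    have := htot.congr (f₂ := fun _ : ℝ => (0 : ℂ)) fun T => by
      have := hrect T
      simp at this
      simpa using this
    simpa using this
  rw [← smul_sub, smul_eq_zero] at h0
  exact (sub_eq_zero.1 (h0.resolve_left Complex.I_ne_zero)).symm

theorem norm_integral_cexp_mul_vertical_le {F : ℂ → ℂ}
    (hF : DifferentiableOn ℂ F {s | 0 < s.re})
    {C p : ℝ} (hp : 1 < p) (hb : ∀ s : ℂ, 0 < s.re → ‖F s‖ ≤ C * ‖s‖ ^ (-p))
    {σ : ℝ} (hσ : 0 < σ) {x : ℝ} (hx : 0 < x) :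
    ‖∫ ξ : ℝ, Complex.exp ((σ + ξ * Complex.I) * x) * F (σ + ξ * Complex.I)‖
      ≤ (Real.exp 1 * C * ∫ ξ : ℝ, ‖((1 : ℝ) + ξ * Complex.I : ℂ)‖ ^ (-p)) * x ^ (p - 1) := by
  have hxi : 0 < x⁻¹ := by positivity
  rw [integral_cexp_mul_vertical_eq hF hp hb hσ hxi hx]
  refine (norm_integral_le_of_norm_le (((integrable_norm_add_mul_I_rpow hxi hp).const_mul
    (Real.exp 1 * C))) (.of_forall fun ξ => ?_)).trans_eq ?_
  · have := hb ((x⁻¹ : ℝ) + ξ * Complex.I) (by simpa using hx)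
    rw [norm_mul, Complex.norm_exp, mul_assoc]
    refine mul_le_mul (le_of_eq ?_) this (norm_nonneg _) (Real.exp_pos _).le
    simp [hx.ne']
  · rw [integral_const_mul, mul_assoc (Real.exp 1 * C)]
    congr 1
    have h := Measure.integral_comp_mul_left
      (fun ξ : ℝ => ‖((1 : ℝ) + ξ * Complex.I : ℂ)‖ ^ (-p)) x
    rw [abs_of_pos hxi, eq_inv_smul_iff₀ hx.ne', smul_eq_mul] at h
    rw [← h, mul_right_comm, ← Real.rpow_one_add' hx.le (by linarith), ← integral_const_mul]
    refine integral_congr_ae (.of_forall fun ξ => ?_)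
    have hx0 : (x : ℂ) ≠ 0 := by exact_mod_cast hx.ne'
    simp only
    rw [show ((x⁻¹ : ℝ) + ξ * Complex.I : ℂ) = ((x⁻¹ : ℝ) : ℂ) * ((1 : ℝ) + (x * ξ : ℝ) * Complex.I) by
      push_cast; field_simp, norm_mul, Real.mul_rpow (norm_nonneg _) (norm_nonneg _),
      Complex.norm_real, Real.norm_of_nonneg hxi.le, Real.inv_rpow hx.le, Real.rpow_neg hx.le,
      inv_inv, add_sub_cancel]

/-- The Laplace transform `s ^ (a - 1) / (s ^ a - l)` of `t ↦ E_a(l t ^ a)`. -/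
noncomputable def mittagLefflerLaplace (a : ℝ) (l s : ℂ) : ℂ :=
  s ^ ((a : ℂ) - 1) / (s ^ (a : ℂ) - l)

theorem eq_I_of_cpow_eq {a : ℝ} (ha₀ : 0 < a) (ha₂ : a < 2) {s : ℂ} (hs : 0 ≤ s.re) (hs0 : s ≠ 0)
    (h : s ^ (a : ℂ) = Complex.I ^ (a : ℂ)) : s = Complex.I := by
  rw [Complex.cpow_def_of_ne_zero hs0, Complex.cpow_def_of_ne_zero Complex.I_ne_zero,
    Complex.exp_eq_exp_iff_exists_int, Complex.log_I] at h
  obtain ⟨n, hn⟩ := h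
  have hre := congrArg Complex.re hn
  have him := congrArg Complex.im hn
  simp [Complex.log_re, ha₀.ne'] at hre
  simp [Complex.log_im] at him
  have harg := abs_le.1 (Complex.abs_arg_le_pi_div_two_iff.2 hs)
  have hπ := Real.pi_pos
  have hn0 : n = 0 := by
    have h1 : (-1 : ℝ) < n := by
      by_contra! hc
      nlinarith [mul_le_mul_of_nonneg_right harg.1 ha₀.le, mul_le_mul_of_nonneg_right hc hπ.le]
    have h2 : (n : ℝ) < 1 := by
      by_contra! hc
      nlinarith [mul_le_mul_of_nonneg_right harg.2 ha₀.le, mul_le_mul_of_nonneg_right hc hπ.le]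
    have h1' : -1 < n := by exact_mod_cast h1
    have h2' : n < 1 := by exact_mod_cast h2
    omega
  have ha' : (a : ℂ) ≠ 0 := by exact_mod_cast ha₀.ne'
  rw [hn0] at hn
  have hl : Complex.log s = Complex.log Complex.I := by
    rw [Complex.log_I]
    exact mul_right_cancel₀ ha' (by simpa using hn)
  rw [← Complex.exp_log hs0, hl, Complex.exp_log Complex.I_ne_zero]

theorem norm_I_cpow_ofReal (a : ℝ) : ‖Complex.I ^ (a : ℂ)‖ = 1 := by
  simp [Complex.norm_cpow_real]

theorem mem_slitPlane_of_mem_closedBall {s w : ℂ} (hs : 0 < s.re)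
    (hw : w ∈ Metric.closedBall s (‖s‖ / 2)) : w ∈ Complex.slitPlane := by
  rw [Complex.mem_slitPlane_iff]
  by_contra! hc
  rw [Metric.mem_closedBall, dist_eq_norm] at hw
  have h1 : ‖s‖ ^ 2 ≤ ‖w - s‖ ^ 2 := by
    rw [Complex.sq_norm, Complex.sq_norm, Complex.normSq_apply, Complex.normSq_apply]
    simp [hc.2]
    nlinarith [hc.1]
  have h2 : 0 < ‖s‖ := norm_pos_iff.2 fun h => by simp [h] at hs
  nlinarith [norm_nonneg (w - s)]

theorem differentiableAt_mittagLefflerLaplace {a : ℝ} {l s : ℂ} (hs : s ∈ Complex.slitPlane)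
    (h : s ^ (a : ℂ) - l ≠ 0) : DifferentiableAt ℂ (mittagLefflerLaplace a l) s := by
  unfold mittagLefflerLaplace
  refine DifferentiableAt.div ?_ ?_ h
  · exact DifferentiableAt.cpow (by fun_prop) (by fun_prop) hs
  · exact (DifferentiableAt.cpow (by fun_prop) (by fun_prop) hs).sub_const _

/-- Cauchy's estimate on the disc of radius `‖s‖ / 2` about `s`. -/
theorem norm_deriv_deriv_mittagLefflerLaplace_le {a : ℝ} {l s : ℂ} (hs : 0 < s.re) {B : ℝ}
    (h0 : ∀ w ∈ Metric.closedBall s (‖s‖ / 2), w ^ (a : ℂ) - l ≠ 0)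
    (hB : ∀ w ∈ Metric.closedBall s (‖s‖ / 2), ‖mittagLefflerLaplace a l w‖ ≤ B) :
    ‖deriv (deriv (mittagLefflerLaplace a l)) s‖ ≤ 8 * B / ‖s‖ ^ 2 := by
  have hs0 : 0 < ‖s‖ := norm_pos_iff.2 fun h => by simp [h] at hs
  have hd : DifferentiableOn ℂ (mittagLefflerLaplace a l) (Metric.closedBall s (‖s‖ / 2)) :=
    fun w hw => (differentiableAt_mittagLefflerLaplace (mem_slitPlane_of_mem_closedBall hs hw)
      (h0 w hw)).differentiableWithinAt
  have := Complex.norm_iteratedDeriv_le_of_forall_mem_sphere_norm_le 2 (by positivity)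
    (hd.diffContOnCl_ball subset_rfl) fun w hw => hB w (Metric.sphere_subset_closedBall hw)
  rw [iteratedDeriv_succ, iteratedDeriv_one] at this
  refine this.trans_eq ?_
  field_simp
  norm_num [Nat.factorial]
  ring

theorem norm_cpow_ofReal_sub_one {a : ℝ} (w : ℂ) : ‖w ^ ((a : ℂ) - 1)‖ = ‖w‖ ^ (a - 1) := by
  have := Complex.norm_cpow_real w (a - 1)
  push_cast at this
  exact this

theorem norm_deriv_deriv_mittagLefflerLaplace_le_of_small {a : ℝ} (ha₁ : 1 < a) (ha₂ : a < 2)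
    {l s : ℂ} (hl : ‖l‖ = 1) (hs : 0 < s.re) (hs' : ‖s‖ ≤ 1 / 3) :
    ‖deriv (deriv (mittagLefflerLaplace a l)) s‖ ≤ 24 * ‖s‖ ^ (-(3 - a)) := by
  have hs0 : 0 < ‖s‖ := norm_pos_iff.2 fun h => by simp [h] at hs
  have hw (w : ℂ) (hw : w ∈ Metric.closedBall s (‖s‖ / 2)) : ‖w‖ ≤ 3 / 2 * ‖s‖ := by
    rw [Metric.mem_closedBall, dist_eq_norm] at hw
    have := norm_le_norm_add_norm_sub' w s
    linarith
  have hden (w : ℂ) (hwm : w ∈ Metric.closedBall s (‖s‖ / 2)) : 1 / 2 ≤ ‖w ^ (a : ℂ) - l‖ := by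
    have h1 : ‖w ^ (a : ℂ)‖ ≤ 1 / 2 := by
      rw [Complex.norm_cpow_real]
      calc ‖w‖ ^ a ≤ (1 / 2 : ℝ) ^ a :=
            Real.rpow_le_rpow (norm_nonneg _) (by linarith [hw w hwm]) (by linarith)
        _ ≤ (1 / 2 : ℝ) ^ (1 : ℝ) :=
            Real.rpow_le_rpow_of_exponent_ge (by norm_num) (by norm_num) ha₁.le
        _ = 1 / 2 := Real.rpow_one _
    have := norm_sub_norm_le l (w ^ (a : ℂ))
    rw [norm_sub_rev, hl] at this
    linarith
  have hmain := norm_deriv_deriv_mittagLefflerLaplace_le (a := a) (l := l) hs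
    (B := 3 * ‖s‖ ^ (a - 1))
    (fun w hwm h => by have := hden w hwm; rw [h, norm_zero] at this; linarith) fun w hwm => by
      rw [mittagLefflerLaplace, norm_div, norm_cpow_ofReal_sub_one,
        div_le_iff₀ (by linarith [hden w hwm])]
      have h1 : ‖w‖ ^ (a - 1) ≤ 3 / 2 * ‖s‖ ^ (a - 1) :=
        calc ‖w‖ ^ (a - 1) ≤ (3 / 2 * ‖s‖) ^ (a - 1) :=
              Real.rpow_le_rpow (norm_nonneg _) (hw w hwm) (by linarith)
          _ = (3 / 2) ^ (a - 1) * ‖s‖ ^ (a - 1) := Real.mul_rpow (by norm_num) hs0.le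
          _ ≤ (3 / 2) ^ (1 : ℝ) * ‖s‖ ^ (a - 1) := by
              gcongr
              · norm_num
              · linarith
          _ = 3 / 2 * ‖s‖ ^ (a - 1) := by rw [Real.rpow_one]
      have h2 : 0 ≤ ‖s‖ ^ (a - 1) := by positivity
      nlinarith [hden w hwm]
  refine hmain.trans_eq ?_
  rw [show -(3 - a) = (a - 1) - 2 by ring, Real.rpow_sub hs0 (a - 1) 2, Real.rpow_ofNat]
  ring

theorem norm_deriv_deriv_mittagLefflerLaplace_le_of_large {a : ℝ} (ha₁ : 1 < a)
    {l s : ℂ} (hl : ‖l‖ = 1) (hs : 0 < s.re) (hs' : 4 ≤ ‖s‖) :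
    ‖deriv (deriv (mittagLefflerLaplace a l)) s‖ ≤ 32 * ‖s‖ ^ (-(3 - a)) := by
  have hw (w : ℂ) (hw : w ∈ Metric.closedBall s (‖s‖ / 2)) : ‖s‖ / 2 ≤ ‖w‖ := by
    rw [Metric.mem_closedBall, dist_eq_norm] at hw
    have := norm_le_norm_add_norm_sub w s
    linarith
  have hden (w : ℂ) (hwm : w ∈ Metric.closedBall s (‖s‖ / 2)) :
      ‖w‖ ^ a / 2 ≤ ‖w ^ (a : ℂ) - l‖ := by
    have h2 : 2 ≤ ‖w‖ := by linarith [hw w hwm]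
    have h1 : 2 ≤ ‖w‖ ^ a := h2.trans <| by
      simpa using Real.rpow_le_rpow_of_exponent_le (show 1 ≤ ‖w‖ by linarith) ha₁.le
    have := norm_sub_norm_le (w ^ (a : ℂ)) l
    rw [hl, Complex.norm_cpow_real] at this
    linarith
  have hpos (w : ℂ) (hwm : w ∈ Metric.closedBall s (‖s‖ / 2)) : 0 < ‖w‖ := by linarith [hw w hwm]
  have hpos' (w : ℂ) (hwm : w ∈ Metric.closedBall s (‖s‖ / 2)) : 0 < ‖w ^ (a : ℂ) - l‖ :=
    lt_of_lt_of_le (by have := hpos w hwm; positivity) (hden w hwm)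
  have hmain := norm_deriv_deriv_mittagLefflerLaplace_le (a := a) (l := l) hs
    (B := 4 / ‖s‖) (fun w hwm => norm_pos_iff.1 (hpos' w hwm)) fun w hwm => by
      rw [mittagLefflerLaplace, norm_div, norm_cpow_ofReal_sub_one,
        div_le_iff₀ (hpos' w hwm), Real.rpow_sub (hpos w hwm), Real.rpow_one]
      have h0 := hpos w hwm
      calc ‖w‖ ^ a / ‖w‖ ≤ ‖w‖ ^ a / (‖s‖ / 2) := by
            gcongr
            exact hw w hwm
        _ = 4 / ‖s‖ * (‖w‖ ^ a / 2) := by field_simp; norm_num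
        _ ≤ _ := by gcongr; exact hden w hwm
  refine hmain.trans ?_
  have h3 : ‖s‖ ^ (-(3 : ℝ)) ≤ ‖s‖ ^ (-(3 - a)) :=
    Real.rpow_le_rpow_of_exponent_le (by linarith) (by linarith)
  rw [Real.rpow_neg (norm_nonneg _), Real.rpow_ofNat] at h3
  calc 8 * (4 / ‖s‖) / ‖s‖ ^ 2 = 32 * (‖s‖ ^ 3)⁻¹ := by field_simp; norm_num
    _ ≤ _ := by gcongr

theorem deriv_deriv_const_div_sub (c p s : ℂ) (hs : s ≠ p) :
    deriv (deriv fun w => c / (w - p)) s = 2 * c / (s - p) ^ 3 := by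
  have h1 : (deriv fun w => c / (w - p)) =ᶠ[nhds s] fun w => -c / (w - p) ^ 2 := by
    filter_upwards [isOpen_ne.mem_nhds hs] with w hw
    have := ((hasDerivAt_id w).sub_const p).inv (sub_ne_zero.2 hw) |>.const_mul c
    simp only [div_eq_mul_inv]
    refine HasDerivAt.deriv (this.congr_deriv ?_)
    simp; ring
  rw [h1.deriv_eq]
  have h0 := sub_ne_zero.2 hs
  have := (((hasDerivAt_id s).sub_const p).pow 2).inv (pow_ne_zero 2 h0) |>.const_mul (-c)
  simp only [div_eq_mul_inv]
  refine HasDerivAt.deriv (this.congr_deriv ?_)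
  simp
  field_simp

/-- After removal of its polar part, the Laplace transform extends holomorphically through the pole
at `I`; hence its second derivative is bounded on half-annuli. -/
theorem exists_norm_deriv_deriv_mittagLefflerLaplace_sub_le {a : ℝ} (ha₀ : 0 < a) (ha₂ : a < 2)
    {r R : ℝ} (hr : 0 < r) :
    ∃ M : ℝ, ∀ s : ℂ, 0 < s.re → r ≤ ‖s‖ → ‖s‖ ≤ R →
      ‖deriv (deriv (mittagLefflerLaplace a (Complex.I ^ (a : ℂ)))) s
        - 2 * (1 / (a : ℂ)) / (s - Complex.I) ^ 3‖ ≤ M := by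
  have ha' : (a : ℂ) ≠ 0 := by exact_mod_cast ha₀.ne'
  set φ : ℂ → ℂ := fun s => s ^ (a : ℂ) - Complex.I ^ (a : ℂ) with hφ
  set ψ : ℂ → ℂ := dslope φ Complex.I with hψ
  have hφ' (s : ℂ) (hs : s ∈ Complex.slitPlane) :
      HasDerivAt φ (a * s ^ ((a : ℂ) - 1)) s := by
    exact (((hasDerivAt_id s).cpow_const (c := (a : ℂ)) hs).sub_const _).congr_deriv (by simp)
  have hI : Complex.I ∈ Complex.slitPlane := by simp [Complex.mem_slitPlane_iff]
  have hψd : DifferentiableOn ℂ ψ Complex.slitPlane :=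
    (Complex.differentiableOn_dslope (Complex.isOpen_slitPlane.mem_nhds hI)).2 fun s hs =>
      (hφ' s hs).differentiableAt.differentiableWithinAt
  have hφψ (s : ℂ) : φ s = (s - Complex.I) * ψ s := by
    have := sub_smul_dslope φ Complex.I s
    rw [smul_eq_mul] at this
    rw [hψ, this]
    simp [hφ]
  have hψ0 (s : ℂ) (hs : 0 ≤ s.re) (hs0 : s ≠ 0) : ψ s ≠ 0 := by
    by_cases h : s = Complex.I
    · rw [h, hψ, dslope_same, (hφ' _ hI).deriv]
      exact mul_ne_zero ha' (by simp [Complex.cpow_eq_zero_iff])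
    · intro h0
      have := hφψ s
      rw [h0, mul_zero] at this
      exact h (eq_I_of_cpow_eq ha₀ ha₂ hs hs0 (sub_eq_zero.1 this))
  set U : Set ℂ := Complex.slitPlane ∩ ψ ⁻¹' {0}ᶜ with hU
  have hUo : IsOpen U :=
    hψd.continuousOn.isOpen_inter_preimage Complex.isOpen_slitPlane isOpen_compl_singleton
  set g : ℂ → ℂ := fun s => deriv ψ s / (a * ψ s) with hg
  have hgd : DifferentiableOn ℂ g U := by
    refine DifferentiableOn.div ((hψd.deriv Complex.isOpen_slitPlane).mono inter_subset_left)
      ((hψd.mono inter_subset_left).const_mul _) fun s hs => mul_ne_zero ha' hs.2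
  set K : Set ℂ := {s | 0 ≤ s.re} ∩ ({s | r ≤ ‖s‖} ∩ Metric.closedBall 0 R) with hK
  have hKc : IsCompact K := by
    refine IsCompact.inter_left ?_ (isClosed_le continuous_const Complex.continuous_re)
    exact (isCompact_closedBall 0 R).inter_left (isClosed_le continuous_const continuous_norm)
  have hpos (s : ℂ) (hs : 0 ≤ s.re) (hs0 : s ≠ 0) : s ∈ U := by
    refine ⟨?_, hψ0 s hs hs0⟩
    rw [Complex.mem_slitPlane_iff]
    by_contra! hc
    exact hs0 (Complex.ext (le_antisymm hc.1 hs) hc.2)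
  have hKU : K ⊆ U := fun s hs => hpos s hs.1 fun h => by
    have := hs.2.1
    simp [h] at this
    linarith
  have hgdd := (hgd.deriv hUo).deriv hUo
  obtain ⟨M, hM⟩ := hKc.exists_bound_of_continuousOn (hgdd.continuousOn.mono hKU)
  refine ⟨M, fun s hs hrs hsR => ?_⟩
  have hopen : IsOpen {s : ℂ | 0 < s.re} := isOpen_lt continuous_const Complex.continuous_re
  have hne (w : ℂ) (hw : 0 < w.re) : w ≠ Complex.I := fun h => by simp [h] at hw
  have hne0 (w : ℂ) (hw : 0 < w.re) : w ≠ 0 := fun h => by simp [h] at hw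
  have heq : ∀ w : ℂ, 0 < w.re → mittagLefflerLaplace a (Complex.I ^ (a : ℂ)) w
      = g w + 1 / (a : ℂ) / (w - Complex.I) := by
    intro w hw
    have hwU := hpos w hw.le (hne0 w hw)
    have hwI := sub_ne_zero.2 (hne w hw)
    have hd : HasDerivAt φ (1 * ψ w + (w - Complex.I) * deriv ψ w) w := by
      rw [funext hφψ]
      exact ((hasDerivAt_id w).sub_const _).mul
        (hψd.differentiableAt (Complex.isOpen_slitPlane.mem_nhds hwU.1)).hasDerivAt
    have h1 := (hφ' w hwU.1).unique hd
    have h2 : mittagLefflerLaplace a (Complex.I ^ (a : ℂ)) w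
        = a * w ^ ((a : ℂ) - 1) / (a * φ w) := by
      rw [mittagLefflerLaplace, mul_div_mul_left _ _ ha']
    have hψw : ψ w ≠ 0 := hwU.2
    rw [h2, h1, hφψ, hg]
    simp only
    field_simp
    ring
  have hdg (w : ℂ) (hw : 0 < w.re) : DifferentiableAt ℂ g w :=
    hgd.differentiableAt (hUo.mem_nhds (hpos w hw.le (hne0 w hw)))
  have hdq (w : ℂ) (hw : 0 < w.re) : DifferentiableAt ℂ (fun w => 1 / (a : ℂ) / (w - Complex.I)) w :=
    DifferentiableAt.div (by fun_prop) (by fun_prop) (sub_ne_zero.2 (hne w hw))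
  have hdq' : DifferentiableOn ℂ (fun w => 1 / (a : ℂ) / (w - Complex.I)) {s : ℂ | 0 < s.re} :=
    fun w hw => (hdq w hw).differentiableWithinAt
  have hd1 : deriv (mittagLefflerLaplace a (Complex.I ^ (a : ℂ))) =ᶠ[nhds s]
      fun w => deriv g w + deriv (fun w => 1 / (a : ℂ) / (w - Complex.I)) w := by
    filter_upwards [hopen.mem_nhds hs] with w hw
    rw [← deriv_fun_add (hdg w hw) (hdq w hw)]
    refine Filter.EventuallyEq.deriv_eq ?_
    filter_upwards [hopen.mem_nhds hw] with v hv using heq v hv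
  have hsU := hpos s hs.le (hne0 s hs)
  rw [hd1.deriv_eq, deriv_fun_add ((hgd.deriv hUo).differentiableAt (hUo.mem_nhds hsU))
    ((hdq'.deriv hopen).differentiableAt (hopen.mem_nhds hs)),
    deriv_deriv_const_div_sub _ _ _ (hne s hs), add_sub_cancel_right]
  exact hM s ⟨hs.le, hrs, by simpa using hsR⟩

theorem exists_norm_deriv_deriv_mittagLefflerLaplace_sub_le_rpow {a : ℝ} (ha₁ : 1 < a)
    (ha₂ : a < 2) :
    ∃ C : ℝ, ∀ s : ℂ, 0 < s.re →
      ‖deriv (deriv (mittagLefflerLaplace a (Complex.I ^ (a : ℂ)))) s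
        - 2 * (1 / (a : ℂ)) / (s - Complex.I) ^ 3‖ ≤ C * ‖s‖ ^ (-(3 - a)) := by
  obtain ⟨M, hM⟩ := exists_norm_deriv_deriv_mittagLefflerLaplace_sub_le (a := a) (by linarith) ha₂
    (r := 1 / 3) (R := 4) (by norm_num)
  have hpole (s : ℂ) (hs : s ≠ Complex.I) :
      ‖2 * (1 / (a : ℂ)) / (s - Complex.I) ^ 3‖ ≤ 2 / ‖s - Complex.I‖ ^ 3 := by
    have h0 : 0 < ‖s - Complex.I‖ := norm_pos_iff.2 (sub_ne_zero.2 hs)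
    rw [norm_div, norm_pow]
    gcongr
    have : a⁻¹ ≤ 1 := inv_le_one_of_one_le₀ ha₁.le
    simpa [abs_of_pos (show 0 < a by linarith)] using this
  refine ⟨48 + 16 * |M|, fun s hs => ?_⟩
  have hs0 : 0 < ‖s‖ := norm_pos_iff.2 fun h => by simp [h] at hs
  have hsI : s ≠ Complex.I := fun h => by simp [h] at hs
  have hp : 0 < ‖s‖ ^ (-(3 - a)) := by positivity
  have hMp : 0 ≤ |M| * ‖s‖ ^ (-(3 - a)) := by positivity
  rcases le_total ‖s‖ (1 / 3) with h1 | h1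
  · refine (norm_sub_le _ _).trans ?_
    have h2 := norm_deriv_deriv_mittagLefflerLaplace_le_of_small ha₁ ha₂ (norm_I_cpow_ofReal a) hs h1
    have h3 : 2 / 3 ≤ ‖s - Complex.I‖ := by
      have := norm_sub_norm_le Complex.I s
      rw [norm_sub_rev, Complex.norm_I] at this
      linarith
    have h4 : 2 / ‖s - Complex.I‖ ^ 3 ≤ 2 / (2 / 3) ^ 3 := by gcongr
    have h5 : 1 ≤ ‖s‖ ^ (-(3 - a)) :=
      Real.one_le_rpow_of_pos_of_le_one_of_nonpos hs0 (by linarith) (by linarith)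
    have := hpole s hsI
    norm_num at h4
    nlinarith
  rcases le_total ‖s‖ 4 with h4 | h4
  · refine ((hM s hs h1 h4).trans (le_abs_self M)).trans ?_
    have h5 : (1 / 16 : ℝ) ≤ ‖s‖ ^ (-(3 - a)) :=
      calc (1 / 16 : ℝ) = 4 ^ (-2 : ℝ) := by
            rw [Real.rpow_neg (by norm_num), Real.rpow_ofNat]; norm_num
        _ ≤ 4 ^ (-(3 - a)) := Real.rpow_le_rpow_of_exponent_le (by norm_num) (by linarith)
        _ ≤ ‖s‖ ^ (-(3 - a)) := Real.rpow_le_rpow_of_nonpos hs0 h4 (by linarith)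
    nlinarith [abs_nonneg M]
  · refine (norm_sub_le _ _).trans ?_
    have h2 := norm_deriv_deriv_mittagLefflerLaplace_le_of_large ha₁ (norm_I_cpow_ofReal a) hs h4
    have h3 : ‖s‖ / 2 ≤ ‖s - Complex.I‖ := by
      have := norm_sub_norm_le s Complex.I
      rw [Complex.norm_I] at this
      linarith
    have h5 : 2 / ‖s - Complex.I‖ ^ 3 ≤ 2 / (‖s‖ / 2) ^ 3 := by gcongr
    have h6 : ‖s‖ ^ (-(3 : ℝ)) ≤ ‖s‖ ^ (-(3 - a)) :=
      Real.rpow_le_rpow_of_exponent_le (by linarith) (by linarith)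
    rw [Real.rpow_neg (norm_nonneg _), Real.rpow_ofNat] at h6
    have h7 : 2 / (‖s‖ / 2) ^ 3 = 16 * (‖s‖ ^ 3)⁻¹ := by field_simp; norm_num
    have := hpole s hsI
    nlinarith

theorem norm_cpow_neg_le {a c : ℝ} (ha : 1 ≤ a) {r : ℝ} (hr : 1 ≤ r) {w : ℂ}
    (hw : r ≤ ‖w‖) (k : ℕ) : ‖w ^ (-(a * k + c) : ℂ)‖ ≤ (r⁻¹) ^ k * ‖w‖ ^ (-c) := by
  have hw0 : 0 < ‖w‖ := by linarith
  have h := Complex.norm_cpow_real w (-(a * k + c))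
  push_cast at h
  rw [h, neg_add, Real.rpow_add hw0]
  gcongr
  rw [inv_pow, ← Real.rpow_natCast, ← Real.rpow_neg (by linarith)]
  calc ‖w‖ ^ (-(a * k)) ≤ r ^ (-(a * k)) :=
        Real.rpow_le_rpow_of_nonpos (by linarith) hw (by have : 0 ≤ a * k := by positivity
                                                         linarith)
    _ ≤ r ^ (-(k : ℝ)) := by
        refine Real.rpow_le_rpow_of_exponent_le hr ?_
        have : (0 : ℝ) ≤ k := by positivity
        nlinarith

theorem hasSum_mittagLefflerLaplace {a : ℝ} (ha : 1 ≤ a) {l : ℂ} (hl : ‖l‖ = 1) {w : ℂ}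
    (hw : 1 < w.re) :
    HasSum (fun k : ℕ => l ^ k * w ^ (-(a * k + 1) : ℂ)) (mittagLefflerLaplace a l w) := by
  have hn : 1 < ‖w‖ := hw.trans_le (Complex.re_le_norm w)
  have hw0 : w ≠ 0 := norm_pos_iff.1 (by linarith)
  have hwa : 1 < ‖w ^ (a : ℂ)‖ := by
    rw [Complex.norm_cpow_real]
    exact Real.one_lt_rpow hn (by linarith)
  have hwa0 : w ^ (a : ℂ) ≠ 0 := norm_pos_iff.1 (by linarith)
  have hd : w ^ (a : ℂ) - l ≠ 0 := fun h => by
    rw [sub_eq_zero.1 h, hl] at hwa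
    exact lt_irrefl _ hwa
  have hg := (hasSum_geometric_of_norm_lt_one (ξ := l * (w ^ (a : ℂ))⁻¹) (by
    rw [norm_mul, hl, one_mul, norm_inv]; exact inv_lt_one_of_one_lt₀ hwa)).mul_left w⁻¹
  convert! hg using 1
  · ext k
    rw [mul_pow, neg_add, Complex.cpow_add _ _ hw0, Complex.cpow_neg_one, ← Complex.cpow_neg,
      ← Complex.cpow_nat_mul]
    rw [show (k : ℂ) * -(a : ℂ) = -(a * k) by ring]
    ring
  · rw [mittagLefflerLaplace, Complex.cpow_sub _ _ hw0, Complex.cpow_one]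
    have : 1 - l * (w ^ (a : ℂ))⁻¹ ≠ 0 := by
      intro h
      apply hd
      field_simp at h
      rwa [mul_zero] at h
    field_simp

theorem hasDerivAt_cpow_neg {w : ℂ} (hw : 0 < w.re) (b c : ℂ) :
    HasDerivAt (fun w : ℂ => c * w ^ (-b)) (c * -b * w ^ (-(b + 1))) w := by
  have h := ((hasDerivAt_id w).cpow_const (c := -b) (.inl hw)).const_mul c
  refine h.congr_deriv ?_
  rw [neg_add]
  simp [sub_eq_add_neg]
  ring

theorem hasSum_deriv_deriv_mittagLefflerLaplace {a : ℝ} (ha : 1 ≤ a) {l : ℂ} (hl : ‖l‖ = 1) {s : ℂ}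
    (hs : 3 / 2 < s.re) :
    HasSum (fun k : ℕ => l ^ k * ((a * k + 1) * (a * k + 2)) * s ^ (-(a * k + 3) : ℂ))
      (deriv (deriv (mittagLefflerLaplace a l)) s) := by
  set U : Set ℂ := {w | 3 / 2 < w.re} with hU
  have hUo : IsOpen U := isOpen_lt continuous_const Complex.continuous_re
  have hUpos (w : ℂ) (hw : w ∈ U) : 0 < w.re := lt_trans (by norm_num) hw
  have hUn (w : ℂ) (hw : w ∈ U) : 3 / 2 ≤ ‖w‖ := (le_of_lt hw).trans (Complex.re_le_norm w)
  have hbound (w : ℂ) (hw : w ∈ U) (c : ℝ) (hc : 0 ≤ c) (k : ℕ) :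
      ‖w ^ (-(a * k + c) : ℂ)‖ ≤ (2 / 3 : ℝ) ^ k := by
    refine (norm_cpow_neg_le ha (by norm_num) (hUn w hw) k).trans ?_
    have : ‖w‖ ^ (-c) ≤ 1 := Real.rpow_le_one_of_one_le_of_nonpos
      (by linarith [hUn w hw]) (by linarith)
    rw [show (3 / 2 : ℝ)⁻¹ = 2 / 3 by norm_num]
    exact mul_le_of_le_one_right (by positivity) this
  have hgeo : Summable fun k : ℕ => (2 / 3 : ℝ) ^ k :=
    summable_geometric_of_lt_one (by norm_num) (by norm_num)
  have hgeo1 : Summable fun k : ℕ => (k : ℝ) * (2 / 3 : ℝ) ^ k := by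
    simpa using summable_pow_mul_geometric_of_norm_lt_one 1 (r := (2 / 3 : ℝ)) (by norm_num)
  have hder1 (k : ℕ) (w : ℂ) (hw : w ∈ U) :
      HasDerivAt (fun w : ℂ => l ^ k * w ^ (-(a * k + 1) : ℂ))
        (l ^ k * -(a * k + 1) * w ^ (-(a * k + 2) : ℂ)) w :=
    (hasDerivAt_cpow_neg (hUpos w hw) _ _).congr_deriv (by congr 3; ring)
  have hder2 (k : ℕ) (w : ℂ) (hw : w ∈ U) :
      HasDerivAt (fun w : ℂ => l ^ k * -(a * k + 1) * w ^ (-(a * k + 2) : ℂ))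
        (l ^ k * -(a * k + 1) * -(a * k + 2) * w ^ (-(a * k + 3) : ℂ)) w :=
    (hasDerivAt_cpow_neg (hUpos w hw) _ _).congr_deriv (by congr 3; ring)
  have h1 (w : ℂ) (hw : w ∈ U) : deriv (mittagLefflerLaplace a l) w =
      ∑' k : ℕ, l ^ k * -(a * k + 1) * w ^ (-(a * k + 2) : ℂ) := by
    have h := Complex.hasSum_deriv_of_summable_norm (U := U) hgeo
      (F := fun (k : ℕ) (w : ℂ) => l ^ k * w ^ (-(a * k + 1) : ℂ))
      (fun k w hw => (hder1 k w hw).differentiableAt.differentiableWithinAt) hUo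
      (fun k w hw => by
        rw [norm_mul, norm_pow, hl, one_pow, one_mul]
        simpa using hbound w hw 1 zero_le_one k) hw
    rw [(h.congr_fun fun k => ((hder1 k w hw).deriv).symm).tsum_eq]
    refine Filter.EventuallyEq.deriv_eq ?_
    filter_upwards [hUo.mem_nhds hw] with v hv
    exact (hasSum_mittagLefflerLaplace ha hl (lt_trans (by norm_num) hv)).tsum_eq.symm
  have h := Complex.hasSum_deriv_of_summable_norm (U := U) ((hgeo1.mul_left a).add hgeo)
      (F := fun (k : ℕ) (w : ℂ) => l ^ k * -(a * k + 1) * w ^ (-(a * k + 2) : ℂ))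
      (fun k w hw => (hder2 k w hw).differentiableAt.differentiableWithinAt) hUo
      (fun k w hw => by
        rw [norm_mul, norm_mul, norm_pow, hl, one_pow, one_mul, norm_neg,
          show (a * k + 1 : ℂ) = ((a * k + 1 : ℝ) : ℂ) by push_cast; ring, Complex.norm_real,
          Real.norm_of_nonneg (by positivity), ← mul_assoc, ← add_one_mul]
        gcongr
        simpa using hbound w hw 2 zero_le_two k) hs
  have heq : deriv (mittagLefflerLaplace a l) =ᶠ[nhds s]
      fun w => ∑' k : ℕ, l ^ k * -(a * k + 1) * w ^ (-(a * k + 2) : ℂ) := by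
    filter_upwards [hUo.mem_nhds hs] with w hw using h1 w hw
  rw [heq.deriv_eq]
  refine h.congr_fun fun k => ?_
  rw [(hder2 k s hs).deriv]
  ring

/-- `x ^ 2 E_a(l x ^ a)` as an inverse Laplace integral. -/
theorem integral_cexp_mul_deriv_deriv_mittagLefflerLaplace_eq {a : ℝ} (ha : 1 ≤ a) {l : ℂ} (hl : ‖l‖ = 1) {x : ℝ}
    (hx : 0 < x) :
    ∫ ξ : ℝ, Complex.exp (((2 : ℝ) + ξ * Complex.I) * x)
        * deriv (deriv (mittagLefflerLaplace a l)) ((2 : ℝ) + ξ * Complex.I)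
      = 2 * Real.pi * ((x : ℂ) ^ 2 * mittagLeffler a 1 (l * (x ^ a : ℝ))) := by
  set G : ℕ → ℝ → ℂ := fun k ξ => (l ^ k * ((a * k + 1) * (a * k + 2))) *
    (Complex.exp (((2 : ℝ) + ξ * Complex.I) * x)
      * ((2 : ℝ) + ξ * Complex.I) ^ (-(((a * k + 2 : ℝ) : ℂ) + 1))) with hG
  have hterm (k : ℕ) : ∫ ξ : ℝ, G k ξ = 2 * Real.pi * ((x : ℂ) ^ 2 *
      ((l * (x ^ a : ℝ)) ^ k / (Real.Gamma (a * k + 1) : ℂ))) := by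
    have hak : 0 ≤ a * k := by positivity
    have hΓ0 : (Real.Gamma (a * k + 1) : ℂ) ≠ 0 := by
      exact_mod_cast (Real.Gamma_pos_of_pos (by linarith)).ne'
    have hΓ : Real.Gamma (a * k + 2 + 1) = (a * k + 2) * ((a * k + 1) * Real.Gamma (a * k + 1)) := by
      rw [Real.Gamma_add_one (by linarith), ← Real.Gamma_add_one (s := a * k + 1) (by linarith)]
      ring_nf
    have h1 : (a * k + 1 : ℂ) ≠ 0 := by exact_mod_cast (show a * k + 1 ≠ 0 by linarith)
    have h2 : (a * k + 2 : ℂ) ≠ 0 := by exact_mod_cast (show a * k + 2 ≠ 0 by linarith)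
    rw [hG, integral_const_mul, integral_cexp_mul_cpow_vertical (by linarith) two_pos hx, hΓ,
      Real.rpow_add hx, Real.rpow_mul hx.le, Real.rpow_natCast, Real.rpow_ofNat]
    push_cast
    field_simp
    ring
  have hnorm (k : ℕ) (ξ : ℝ) : ‖G k ξ‖ ≤ (a * k + 1) * (a * k + 2) * (1 / 2) ^ k * Real.exp (2 * x) *
      ‖((2 : ℝ) + ξ * Complex.I : ℂ)‖ ^ (-(2 : ℝ)) := by
    have h2 : 2 ≤ ‖((2 : ℝ) + ξ * Complex.I : ℂ)‖ := le_norm_add_mul_I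
    have h := norm_cpow_neg_le (c := 3) ha (show (1 : ℝ) ≤ 2 by norm_num) h2 k
    have h3 : ‖((2 : ℝ) + ξ * Complex.I : ℂ)‖ ^ (-(3 : ℝ)) ≤
        ‖((2 : ℝ) + ξ * Complex.I : ℂ)‖ ^ (-(2 : ℝ)) :=
      Real.rpow_le_rpow_of_exponent_le (by linarith) (by norm_num)
    have hexp : ‖Complex.exp (((2 : ℝ) + ξ * Complex.I) * x)‖ = Real.exp (2 * x) := by
      simp [Complex.norm_exp]
    rw [hG]
    simp only
    rw [norm_mul, norm_mul, norm_mul (Complex.exp _), hexp, norm_pow, hl, one_pow, one_mul,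
      show ((a * k + 1) * (a * k + 2) : ℂ) = (((a * k + 1) * (a * k + 2) : ℝ) : ℂ) by push_cast; ring,
      Complex.norm_real, Real.norm_of_nonneg (by positivity),
      show -(((a * k + 2 : ℝ) : ℂ) + 1) = -(a * k + (3 : ℝ)) by push_cast; ring]
    rw [mul_assoc _ ((1 / 2 : ℝ) ^ k), mul_assoc _ ((1 / 2 : ℝ) ^ k * _),
      mul_right_comm ((1 / 2 : ℝ) ^ k), mul_comm ((1 / 2 : ℝ) ^ k * _)]
    gcongr
    refine h.trans ?_
    rw [one_div]
    gcongr
  have hint2 := integrable_norm_add_mul_I_rpow (two_pos (α := ℝ)) (show (1 : ℝ) < 2 by norm_num)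
  have hGi (k : ℕ) : Integrable (G k) := by
    refine (hint2.const_mul _).mono' ?_ (.of_forall (hnorm k))
    apply Measurable.aestronglyMeasurable
    fun_prop
  have hsum : Summable fun k : ℕ => (a * k + 1) * (a * k + 2) * (1 / 2 : ℝ) ^ k := by
    have h0 := summable_pow_mul_geometric_of_norm_lt_one 0 (r := (1 / 2 : ℝ)) (by norm_num)
    have h1 := summable_pow_mul_geometric_of_norm_lt_one 1 (r := (1 / 2 : ℝ)) (by norm_num)
    have h2 := summable_pow_mul_geometric_of_norm_lt_one 2 (r := (1 / 2 : ℝ)) (by norm_num)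
    refine (((h2.mul_left (a ^ 2)).add (h1.mul_left (3 * a))).add (h0.mul_left 2)).congr fun k => ?_
    ring
  have hmain := hasSum_integral_of_summable_integral_norm hGi (by
    refine Summable.of_nonneg_of_le (fun k => integral_nonneg fun ξ => norm_nonneg _)
      (fun k => integral_mono (hGi k).norm (hint2.const_mul _) (hnorm k)) ?_
    simp_rw [integral_const_mul]
    exact (hsum.mul_right _).mul_right _)
  rw [mittagLeffler, ← tsum_mul_left, ← tsum_mul_left, ← tsum_congr hterm, hmain.tsum_eq]
  refine integral_congr_ae (.of_forall fun ξ => ?_)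
  have h := hasSum_deriv_deriv_mittagLefflerLaplace ha hl
    (s := (2 : ℝ) + ξ * Complex.I) (by simp; norm_num)
  simp only
  rw [← h.tsum_eq, ← tsum_mul_left]
  refine tsum_congr fun k => ?_
  rw [hG]
  simp only
  rw [show -(((a * k + 2 : ℝ) : ℂ) + 1) = -(a * k + 3) by push_cast; ring]
  ring

/-- `c x ^ 2 exp (I x)` as an inverse Laplace integral. -/
theorem integral_cexp_mul_pole_eq {x : ℝ} (hx : 0 < x) (c : ℂ) :
    ∫ ξ : ℝ, Complex.exp (((2 : ℝ) + ξ * Complex.I) * x)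
        * (2 * c / ((2 : ℝ) + ξ * Complex.I - Complex.I) ^ 3)
      = 2 * Real.pi * ((x : ℂ) ^ 2 * (c * Complex.exp (Complex.I * x))) := by
  have h := integral_cexp_mul_cpow_vertical (a := 2) two_pos (two_pos (α := ℝ)) hx
  rw [← integral_sub_right_eq_self _ (1 : ℝ)] at h
  have hΓ : Real.Gamma (2 + 1) = 2 := by
    have := Real.Gamma_nat_eq_factorial 2
    simpa [Nat.factorial] using this
  rw [hΓ] at h
  calc _ = ∫ ξ : ℝ, (2 * c * Complex.exp (Complex.I * x)) *
        (Complex.exp (((2 : ℝ) + (ξ - 1 : ℝ) * Complex.I) * x) *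
          ((2 : ℝ) + (ξ - 1 : ℝ) * Complex.I) ^ (-(((2 : ℝ) : ℂ) + 1))) := by
        refine integral_congr_ae (.of_forall fun ξ => ?_)
        simp only
        rw [show -(((2 : ℝ) : ℂ) + 1) = -((3 : ℕ) : ℂ) by push_cast; ring, Complex.cpow_neg,
          Complex.cpow_natCast, show ((2 : ℝ) + ξ * Complex.I) * (x : ℂ)
            = Complex.I * x + ((2 : ℝ) + (ξ - 1 : ℝ) * Complex.I) * x by push_cast; ring,
          Complex.exp_add]
        rw [show ((2 : ℝ) + ξ * Complex.I - Complex.I : ℂ) = (2 : ℝ) + (ξ - 1 : ℝ) * Complex.I by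
          push_cast; ring]
        ring
    _ = _ := by
        rw [integral_const_mul, h, Real.rpow_ofNat]
        push_cast
        ring

theorem mittagLeffler_I_cpow_asymptotics {a : ℝ} (ha₁ : 1 < a) (ha₂ : a < 2) :
    ∃ C : ℝ, ∀ x : ℝ, 0 < x →
      ‖mittagLeffler a 1 (Complex.I ^ (a : ℂ) * (x ^ a : ℝ))
        - 1 / (a : ℂ) * Complex.exp (Complex.I * x)‖ ≤ C * x ^ (-a) := by
  obtain ⟨C, hC⟩ := exists_norm_deriv_deriv_mittagLefflerLaplace_sub_le_rpow ha₁ ha₂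
  set l : ℂ := Complex.I ^ (a : ℂ)
  have hopen : IsOpen {s : ℂ | 0 < s.re} := isOpen_lt continuous_const Complex.continuous_re
  have hne (w : ℂ) (hw : 0 < w.re) : w ≠ Complex.I := fun h => by simp [h] at hw
  have hne0 (w : ℂ) (hw : 0 < w.re) : w ≠ 0 := fun h => by simp [h] at hw
  have hLd : DifferentiableOn ℂ (mittagLefflerLaplace a l) {s : ℂ | 0 < s.re} := fun s hs =>
    (differentiableAt_mittagLefflerLaplace (.inl hs) fun h => hne s hs
      (eq_I_of_cpow_eq (by linarith) ha₂ (le_of_lt hs) (hne0 s hs)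
        (sub_eq_zero.1 h))).differentiableWithinAt
  have hP : DifferentiableOn ℂ (fun s : ℂ => 2 * (1 / (a : ℂ)) / (s - Complex.I) ^ 3)
      {s : ℂ | 0 < s.re} :=
    DifferentiableOn.div (by fun_prop) (by fun_prop) fun s hs =>
      pow_ne_zero 3 (sub_ne_zero.2 (hne s hs))
  have hFd := ((hLd.deriv hopen).deriv hopen).sub hP
  have hp : 1 < 3 - a := by linarith
  refine ⟨(2 * Real.pi)⁻¹ * (Real.exp 1 * C *
    ∫ ξ : ℝ, ‖((1 : ℝ) + ξ * Complex.I : ℂ)‖ ^ (-(3 - a))), fun x hx => ?_⟩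
  have hbd := norm_integral_cexp_mul_vertical_le hFd hp hC (two_pos (α := ℝ)) hx
  have hPi : Integrable fun ξ : ℝ => Complex.exp (((2 : ℝ) + ξ * Complex.I) * x)
        * (2 * (1 / (a : ℂ)) / ((2 : ℝ) + ξ * Complex.I - Complex.I) ^ 3) := by
    by_contra h
    have h0 := integral_cexp_mul_pole_eq hx (1 / (a : ℂ))
    rw [integral_undef h] at h0
    have ha0 : (a : ℂ) ≠ 0 := by exact_mod_cast (show a ≠ 0 by linarith)
    simp [hx.ne', ha0, Real.pi_ne_zero] at h0
  have hFi := integrable_cexp_mul_vertical hFd.continuousOn hp hC (two_pos (α := ℝ)) x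
  have hint : ∫ ξ : ℝ, Complex.exp (((2 : ℝ) + ξ * Complex.I) * x) *
      (deriv (deriv (mittagLefflerLaplace a l)) - fun s : ℂ =>
        2 * (1 / (a : ℂ)) / (s - Complex.I) ^ 3 : ℂ → ℂ) ((2 : ℝ) + ξ * Complex.I) =
      2 * Real.pi * (x : ℂ) ^ 2 * (mittagLeffler a 1 (l * (x ^ a : ℝ))
        - 1 / (a : ℂ) * Complex.exp (Complex.I * x)) := by
    rw [mul_sub, mul_assoc _ _ (mittagLeffler _ _ _), mul_assoc _ _ (1 / (a : ℂ) * _),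
      ← integral_cexp_mul_deriv_deriv_mittagLefflerLaplace_eq ha₁.le (norm_I_cpow_ofReal a) hx,
      ← integral_cexp_mul_pole_eq hx, eq_sub_iff_add_eq, ← integral_add hFi hPi]
    refine integral_congr_ae (.of_forall fun ξ => ?_)
    simp only [Pi.sub_apply]
    ring
  rw [hint, norm_mul, norm_mul, norm_mul, norm_pow, Complex.norm_real, Complex.norm_real,
    Complex.norm_two, Real.norm_of_nonneg Real.pi_pos.le, Real.norm_of_nonneg hx.le] at hbd
  have hpos : 0 < 2 * Real.pi * x ^ 2 := by positivity
  rw [← le_div_iff₀' hpos] at hbd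
  refine hbd.trans_eq ?_
  generalize (∫ ξ : ℝ, ‖((1 : ℝ) + ξ * Complex.I : ℂ)‖ ^ (-(3 - a))) = J
  rw [show 3 - a - 1 = 2 + -a by ring, Real.rpow_add hx, Real.rpow_ofNat]
  field_simp

/-- For `1 < α < 2`, `ω > 0`: `E_α(i^α ω^α t^α) = (1/α) e^{iωt} + O(t^{-α})` as `t → ∞`. -/
theorem mittagLeffler_asymptotics_on_oscillatory_ray
    (α ω : ℝ) (hα₁ : 1 < α) (hα₂ : α < 2) (hω : 0 < ω) :
    ∃ C : ℝ, 0 < C ∧ ∀ t : ℝ, 1 ≤ t →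
      ‖mittagLeffler α 1 (Complex.exp (Real.pi * α / 2 * Complex.I) * ((ω ^ α : ℝ) : ℂ)
            * ((t ^ α : ℝ) : ℂ))
          - (1 / (α : ℂ)) * Complex.exp (Complex.I * ω * t)‖ ≤ C * t ^ (-α) := by
  obtain ⟨C, hC⟩ := mittagLeffler_I_cpow_asymptotics hα₁ hα₂
  have hωp : 0 < ω ^ (-α) := by positivity
  refine ⟨(|C| + 1) * ω ^ (-α), by positivity, fun t ht => ?_⟩
  have ht0 : 0 < t := by linarith
  have h := hC (ω * t) (by positivity)
  have hI : Complex.I ^ (α : ℂ) = Complex.exp (Real.pi * α / 2 * Complex.I) := by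
    rw [Complex.cpow_def_of_ne_zero Complex.I_ne_zero, Complex.log_I]
    congr 1
    ring
  rw [hI, Real.mul_rpow hω.le ht0.le, Real.mul_rpow hω.le ht0.le] at h
  push_cast at h ⊢
  rw [← mul_assoc, ← mul_assoc, ← mul_assoc] at h
  refine h.trans ?_
  have : 0 < t ^ (-α) := by positivity
  gcongr
  linarith [le_abs_self C]
end

section
/- Let 1<α<2. The Mittag-Leffler function E_α has no zeros on the ray arg z = πα/2; that is, for every r>0, E_α(r e^{iπα/2}) ≠ 0. -/
open MeasureTheory Filter Set

open Complex Metric Topology ComplexConjugate in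
theorem herglotz_disc {H : ℂ → ℂ} (hc : ContinuousOn H (closedBall 0 1))
    (hd : DifferentiableOn ℂ H (ball 0 1)) {w : ℂ} (hw : w ∈ ball (0 : ℂ) 1) :
    H w = (2 * Real.pi : ℂ)⁻¹ * ∫ θ in (0 : ℝ)..2 * Real.pi,
      (exp (θ * I) * H (exp (θ * I)) - conj (H (exp (θ * I)))) / (exp (θ * I) - w) := by
  have hw1 : ‖w‖ < 1 := by simpa using hw
  have hdiff : ∀ x ∈ ball (0 : ℂ) 1 \ ∅, DifferentiableAt ℂ H x := fun x hx =>
    hd.differentiableAt (isOpen_ball.mem_nhds hx.1)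
  have hcirc : Continuous fun θ : ℝ => H (exp (θ * I)) :=
    hc.comp_continuous (by fun_prop) fun θ => by simp
  have hne : ∀ θ : ℝ, exp (θ * I) - w ≠ 0 := fun θ h => by
    rw [sub_eq_zero] at h
    rw [← h, norm_exp_ofReal_mul_I] at hw1
    exact lt_irrefl _ hw1
  have h1 := two_pi_I_inv_smul_circleIntegral_sub_inv_smul_of_differentiable_on_off_countable
    countable_empty hw hc hdiff
  have hden : ∀ z ∈ closedBall (0 : ℂ) 1, 1 - conj w * z ≠ 0 := fun z hz h => by
    have hz1 : ‖z‖ ≤ 1 := by simpa using hz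
    have : ‖conj w * z‖ = 1 := by rw [← sub_eq_zero.mp h, norm_one]
    rw [norm_mul, RCLike.norm_conj] at this
    nlinarith [norm_nonneg z, norm_nonneg w]
  have h2 := circleIntegral_eq_zero_of_differentiable_on_off_countable (zero_le_one)
    (f := fun z => H z / (1 - conj w * z)) (c := (0 : ℂ)) countable_empty
    (hc.div (by fun_prop) hden) fun z hz => (hdiff z hz).div (by fun_prop)
      (hden z (ball_subset_closedBall hz.1))
  simp only [circleIntegral, circleMap, deriv_circleMap, ofReal_one, one_mul, zero_add,
    smul_eq_mul] at h1 h2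
  have h3 := congrArg conj h2
  rw [map_zero, ← intervalIntegral.intervalIntegral_conj] at h3
  have h4 : ∫ θ in (0 : ℝ)..2 * Real.pi, conj (H (exp (θ * I))) / (exp (θ * I) - w) = 0 := by
    rw [← mul_eq_zero_iff_left (a := -I) (by simp), ← intervalIntegral.integral_const_mul, ← h3]
    refine intervalIntegral.integral_congr fun θ _ => ?_
    have he : conj (exp (θ * I)) = (exp (θ * I))⁻¹ := by
      rw [← exp_conj, ← exp_neg]; simp
    simp only [map_mul, map_div₀, map_sub, map_one, conj_conj, he, conj_I]
    have := hne θ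
    have h0 := exp_ne_zero (θ * I)
    have h5 : 1 - w * (exp (θ * I))⁻¹ = (exp (θ * I) - w) * (exp (θ * I))⁻¹ := by field_simp
    rw [h5]
    field_simp
  have h5 : ∫ θ in (0 : ℝ)..2 * Real.pi, exp (θ * I) * H (exp (θ * I)) / (exp (θ * I) - w)
      = 2 * Real.pi * H w := by
    rw [← h1, ← intervalIntegral.integral_const_mul, ← intervalIntegral.integral_const_mul]
    refine intervalIntegral.integral_congr fun θ _ => ?_
    have := hne θ
    have hpi : (Real.pi : ℂ) ≠ 0 := by exact_mod_cast Real.pi_ne_zero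
    field_simp
  simp only [sub_div]
  rw [intervalIntegral.integral_sub, h4, h5]
  · have hpi : (Real.pi : ℂ) ≠ 0 := by exact_mod_cast Real.pi_ne_zero
    field_simp
    simp
  · exact (Continuous.div (.mul (by fun_prop) hcirc) (by fun_prop) hne).intervalIntegrable _ _
  · exact (Continuous.div (continuous_conj.comp hcirc) (by fun_prop) hne).intervalIntegrable _ _

open Complex in
theorem re_cayley (w : ℂ) : ((1 + w) / (1 - w)).re = (1 - ‖w‖ ^ 2) / ‖1 - w‖ ^ 2 := by
  rw [← normSq_eq_norm_sq, ← normSq_eq_norm_sq, div_re, ← add_div]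
  congr 1
  simp [normSq_apply]
  ring

open Complex Metric Topology ComplexConjugate in
theorem continuousOn_cayley_update {l : ℂ → ℂ} {c : ℂ}
    (hc : ContinuousOn l {p | 0 ≤ p.re})
    (hlim : Tendsto (fun p => p * l p) (Bornology.cobounded ℂ ⊓ 𝓟 {p | 0 ≤ p.re}) (𝓝 c)) :
    ContinuousOn (Function.update
      (fun w : ℂ => l ((1 + w) / (1 - w)) * ((1 + w) / (1 - w) + 1) / 2) 1 (c / 2))
      (closedBall 0 1) := by
  have hre : ∀ w ∈ closedBall (0 : ℂ) 1, 0 ≤ ((1 + w) / (1 - w)).re := fun w hw => by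
    have hw1 : ‖w‖ ≤ 1 := by simpa using hw
    rw [re_cayley]
    exact div_nonneg (by nlinarith [norm_nonneg w]) (sq_nonneg _)
  intro w hw
  by_cases h1 : w = 1
  · subst h1
    rw [continuousWithinAt_update_same]
    have hφ : Tendsto (fun w : ℂ => (1 + w) / (1 - w)) (𝓝[closedBall 0 1 \ {1}] 1)
        (Bornology.cobounded ℂ ⊓ 𝓟 {p | 0 ≤ p.re}) := by
      refine tendsto_inf.mpr ⟨?_, tendsto_principal.mpr ?_⟩
      · have hinv : Tendsto (fun w : ℂ => (1 - w)⁻¹) (𝓝[≠] 1) (Bornology.cobounded ℂ) := by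
          refine Filter.tendsto_inv₀_nhdsNE_zero.comp (tendsto_nhdsWithin_iff.mpr ⟨?_, ?_⟩)
          · have : Tendsto (fun w : ℂ => 1 - w) (𝓝 1) (𝓝 (1 - 1)) := by
              exact (by fun_prop : Continuous fun w : ℂ => 1 - w).tendsto 1
            rw [sub_self] at this
            exact this.mono_left nhdsWithin_le_nhds
          · filter_upwards [self_mem_nhdsWithin] with x hx
            exact sub_ne_zero.mpr (Ne.symm hx)
        have hinv' : Tendsto (fun w : ℂ => ‖(1 - w)⁻¹‖) (𝓝[closedBall 0 1 \ {1}] 1) atTop :=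
          tendsto_norm_cobounded_atTop.comp
            (hinv.mono_left (nhdsWithin_mono _ fun x hx => hx.2))
        rw [← tendsto_norm_atTop_iff_cobounded]
        refine tendsto_atTop_mono' _ ?_
          (tendsto_atTop_add_const_right _ (-1) (hinv'.const_mul_atTop (two_pos)))
        filter_upwards [self_mem_nhdsWithin] with x hx
        have hx1 : 1 - x ≠ 0 := sub_ne_zero.mpr (Ne.symm hx.2)
        have : (1 + x) / (1 - x) = 2 * (1 - x)⁻¹ - 1 := by field_simp; ring
        rw [this]
        have := norm_sub_norm_le (2 * (1 - x)⁻¹) 1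
        simp only [norm_mul, norm_one, RCLike.norm_ofNat] at this
        linarith
      · filter_upwards [self_mem_nhdsWithin] with x hx using hre x hx.1
    have hinv : Tendsto (fun p : ℂ => p⁻¹) (Bornology.cobounded ℂ ⊓ 𝓟 {p | 0 ≤ p.re}) (𝓝 0) :=
      (tendsto_inv₀_cobounded).mono_left inf_le_left
    have h := hlim.add (hlim.mul hinv)
    have h' : Tendsto (fun p : ℂ => l p * (p + 1) / 2)
        (Bornology.cobounded ℂ ⊓ 𝓟 {p | 0 ≤ p.re}) (𝓝 (c / 2)) := by
      have : Tendsto (fun p : ℂ => (p * l p + p * l p * p⁻¹) / 2)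
          (Bornology.cobounded ℂ ⊓ 𝓟 {p | 0 ≤ p.re}) (𝓝 (c / 2)) := by
        simpa using h.div_const 2
      refine this.congr' ?_
      have hne : ∀ᶠ p : ℂ in Bornology.cobounded ℂ, p ≠ 0 := Bornology.eventually_ne_cobounded 0
      filter_upwards [hne.filter_mono inf_le_left] with p hp
      field_simp
    exact h'.comp hφ
  · rw [continuousWithinAt_update_of_ne h1]
    have h1' : 1 - w ≠ 0 := sub_ne_zero.mpr (Ne.symm h1)
    have hφ : ContinuousWithinAt (fun w : ℂ => (1 + w) / (1 - w)) (closedBall 0 1) w :=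
      ContinuousWithinAt.div (by fun_prop) (by fun_prop) h1'
    have hl : ContinuousWithinAt (fun w : ℂ => l ((1 + w) / (1 - w))) (closedBall 0 1) w :=
      (hc _ (hre w hw)).comp (f := fun w : ℂ => (1 + w) / (1 - w)) hφ hre
    exact (hl.mul (hφ.add continuousWithinAt_const)).div_const 2

open Complex Metric Topology ComplexConjugate in
/-- A function on the right half-plane that is continuous up to the boundary, decays like `c / p`,
and has nonnegative real part of order `O(1 / (1 + x²))` on the imaginary axis is the Laplace
transform of the characteristic function of a finite measure. -/
theorem exists_finite_measure_cauchy_transform {l : ℂ → ℂ} {c : ℂ} {C : ℝ}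
    (hc : ContinuousOn l {p | 0 ≤ p.re}) (hd : DifferentiableOn ℂ l {p | 0 < p.re})
    (hlim : Tendsto (fun p => p * l p) (Bornology.cobounded ℂ ⊓ 𝓟 {p | 0 ≤ p.re}) (𝓝 c))
    (hpos : ∀ x : ℝ, 0 ≤ (l (x * I)).re) (hbd : ∀ x : ℝ, (1 + x ^ 2) * (l (x * I)).re ≤ C) :
    ∃ ν : Measure ℝ, IsFiniteMeasure ν ∧
      ∀ p : ℂ, 0 < p.re → l p = ∫ x : ℝ, 1 / (p - x * I) ∂ν := by
  set ξ : ℝ → ℝ := fun θ => ((1 + exp (θ * I)) / (1 - exp (θ * I))).im with hξ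
  have hξI : ∀ θ : ℝ, (1 + exp (θ * I)) / (1 - exp (θ * I)) = ξ θ * I := fun θ => by
    apply Complex.ext
    · rw [re_cayley, norm_exp_ofReal_mul_I]; simp
    · simp [hξ]
  have hξm : Measurable ξ := by
    refine measurable_im.comp (Measurable.div ?_ ?_)
    · exact (by fun_prop : Continuous fun θ : ℝ => 1 + exp (θ * I)).measurable
    · exact (by fun_prop : Continuous fun θ : ℝ => 1 - exp (θ * I)).measurable
  set d : ℝ → ℝ := fun x => (1 + x ^ 2) * (l (x * I)).re / (2 * Real.pi) with hdd
  have hdc : Continuous d := by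
    have : Continuous fun x : ℝ => l (x * I) := hc.comp_continuous (by fun_prop) (by simp)
    have := continuous_re.comp this
    simp only [hdd]
    exact ((by fun_prop : Continuous fun x : ℝ => 1 + x ^ 2).mul this).div_const _
  have hd0 : ∀ x, 0 ≤ d x := fun x =>
    div_nonneg (mul_nonneg (by positivity) (hpos x)) (by positivity)
  have hdξm : Measurable fun θ => d (ξ θ) := hdc.measurable.comp hξm
  set ρ : Measure ℝ := (volume.restrict (Ioc 0 (2 * Real.pi))).withDensity
    (fun θ => ENNReal.ofReal (d (ξ θ))) with hρ
  have hfin : IsFiniteMeasure ρ := by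
    refine isFiniteMeasure_withDensity_ofReal (Integrable.hasFiniteIntegral ?_)
    refine Integrable.of_bound hdξm.aestronglyMeasurable (C / (2 * Real.pi)) (ae_of_all _ fun θ => ?_)
    rw [Real.norm_of_nonneg (hd0 _)]
    exact div_le_div_of_nonneg_right (hbd _) (by positivity)
  refine ⟨ρ.map ξ, inferInstance, fun p hp => ?_⟩
  have hmeas : Measurable fun x : ℝ => 1 / (p - x * I) := by fun_prop
  rw [integral_map hξm.aemeasurable hmeas.aestronglyMeasurable, hρ,
    integral_withDensity_eq_integral_toReal_smul (by fun_prop) (ae_of_all _ fun _ => ENNReal.ofReal_lt_top)]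
  have hp1 : p + 1 ≠ 0 := fun h => by
    have := congrArg re h
    simp at this
    linarith
  have hw : (p - 1) / (p + 1) ∈ ball (0 : ℂ) 1 := by
    have : ‖p - 1‖ < ‖p + 1‖ := by
      rw [← sq_lt_sq₀ (norm_nonneg _) (norm_nonneg _), ← normSq_eq_norm_sq, ← normSq_eq_norm_sq]
      simp [normSq_apply]
      nlinarith
    simpa using (div_lt_one (norm_pos_iff.mpr hp1)).mpr this
  have hφw : (1 + (p - 1) / (p + 1)) / (1 - (p - 1) / (p + 1)) = p := by
    have : 1 - (p - 1) / (p + 1) = 2 / (p + 1) := by field_simp; ring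
    rw [this]; field_simp; ring
  have hw1 : (p - 1) / (p + 1) ≠ 1 := fun h => by
    rw [h] at hw; simp at hw
  have hH := herglotz_disc (continuousOn_cayley_update hc hlim) (fun z hz => ?_) hw
  · rw [Function.update_of_ne hw1, hφw] at hH
    have hlp : l p = 2 / (p + 1) * (l p * (p + 1) / 2) := by field_simp
    rw [hlp, hH, ← intervalIntegral.integral_const_mul, ← intervalIntegral.integral_const_mul,
      intervalIntegral.integral_of_le (by positivity), integral_Ioc_eq_integral_Ioo,
      integral_Ioc_eq_integral_Ioo]
    refine setIntegral_congr_fun measurableSet_Ioo fun θ hθ => ?_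
    have he1 : exp (θ * I) ≠ 1 := fun h => by
      obtain ⟨n, hn⟩ := exp_eq_one_iff.mp h
      have hn' : θ = n * (2 * Real.pi) := by
        have := congrArg im hn
        simpa using this
      rw [hn'] at hθ
      have hpi := Real.two_pi_pos
      have h0 : (0 : ℝ) < n := by
        by_contra! h
        exact absurd hθ.1 (not_lt.mpr (mul_nonpos_of_nonpos_of_nonneg h hpi.le))
      have h1 : (n : ℝ) < 1 := by
        by_contra! h
        exact absurd hθ.2 (not_lt.mpr (le_mul_of_one_le_left hpi.le h))
      norm_cast at h0 h1
      omega
    simp only [Function.update_of_ne he1, hξI, ENNReal.toReal_ofReal (hd0 _), real_smul]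
    have hξe : exp (θ * I) = (ξ θ * I - 1) / (ξ θ * I + 1) := by
      have hne : 1 - exp (θ * I) ≠ 0 := sub_ne_zero.mpr (Ne.symm he1)
      rw [← hξI]
      have : (1 + exp (θ * I)) / (1 - exp (θ * I)) + 1 = 2 / (1 - exp (θ * I)) := by
        field_simp; ring
      rw [this]; field_simp; ring
    have hx1 : (ξ θ * I + 1 : ℂ) ≠ 0 := fun h => by
      have := congrArg re h
      simp at this
    have hx2 : (-(ξ θ * I) + 1 : ℂ) ≠ 0 := fun h => by
      have := congrArg re h
      simp at this
    have hpx : p - ξ θ * I ≠ 0 := fun h => by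
      have := congrArg re h
      simp at this
      linarith
    have hdz : (d (ξ θ) : ℂ) = (1 - (ξ θ * I) ^ 2) * ((l (ξ θ * I) + conj (l (ξ θ * I))) / 2)
        / (2 * Real.pi) := by
      rw [add_conj, mul_pow, I_sq]
      simp only [hdd]
      push_cast
      ring
    rw [hdz, hξe]
    have hden : (ξ θ * I - 1) / (ξ θ * I + 1) - (p - 1) / (p + 1)
        = - (2 * (p - ξ θ * I)) / ((ξ θ * I + 1) * (p + 1)) := by
      field_simp; ring
    have hpi : (Real.pi : ℂ) ≠ 0 := by exact_mod_cast Real.pi_ne_zero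
    rw [hden]
    simp only [map_mul, map_div₀, map_add, conj_I, conj_ofReal, map_one, map_ofNat, mul_neg]
    generalize conj (l (ξ θ * I)) = L'
    generalize l (ξ θ * I) = L
    field_simp
    ring
  · have hz1 : z ≠ 1 := fun h => by rw [h] at hz; simp at hz
    have hz2 : 1 - z ≠ 0 := sub_ne_zero.mpr (Ne.symm hz1)
    have hz0 : 0 < ((1 + z) / (1 - z)).re := by
      have : ‖z‖ < 1 := by simpa using hz
      rw [re_cayley]
      exact div_pos (by nlinarith [norm_nonneg z]) (by positivity)
    have hφ : DifferentiableAt ℂ (fun w : ℂ => (1 + w) / (1 - w)) z :=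
      DifferentiableAt.div (by fun_prop) (by fun_prop) hz2
    have hl : DifferentiableAt ℂ l ((1 + z) / (1 - z)) :=
      hd.differentiableAt ((isOpen_lt continuous_const continuous_re).mem_nhds hz0)
    have : DifferentiableAt ℂ
        (fun w : ℂ => l ((1 + w) / (1 - w)) * ((1 + w) / (1 - w) + 1) / 2) z :=
      ((hl.comp z hφ).mul (hφ.add_const 1)).div_const 2
    refine (this.congr_of_eventuallyEq ?_).differentiableWithinAt
    filter_upwards [isOpen_ne.mem_nhds hz1] with y hy using Function.update_of_ne hy _ _

namespace Complex

theorem ofReal_mul_cpow {x : ℝ} (hx : 0 < x) {z : ℂ} (hz : z ≠ 0) (a : ℝ) :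
    ((x : ℂ) * z) ^ (a : ℂ) = ((x ^ a : ℝ) : ℂ) * z ^ (a : ℂ) := by
  have hx' : (x : ℂ) ≠ 0 := by exact_mod_cast hx.ne'
  rw [ofReal_cpow hx.le, cpow_def_of_ne_zero (mul_ne_zero hx' hz), cpow_def_of_ne_zero hx',
    cpow_def_of_ne_zero hz, log_ofReal_mul hx hz, ← exp_add, ofReal_log hx.le]
  ring_nf

theorem I_cpow (a : ℝ) : I ^ (a : ℂ) = exp (Real.pi * a / 2 * I) := by
  rw [cpow_def_of_ne_zero I_ne_zero, log_I]
  ring_nf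

theorem neg_I_cpow (a : ℝ) : (-I) ^ (a : ℂ) = exp (-(Real.pi * a / 2 * I)) := by
  rw [cpow_def_of_ne_zero (neg_ne_zero.mpr I_ne_zero), log_neg_I]
  ring_nf

theorem eq_I_of_cpow_eq {α : ℝ} (hα₁ : 1 < α) (hα₂ : α < 2) {p : ℂ} (hp : 0 ≤ p.re)
    (h : p ^ (α : ℂ) = I ^ (α : ℂ)) : p = I := by
  have hα0 : (α : ℂ) ≠ 0 := by exact_mod_cast (by linarith : α ≠ 0)
  have hp0 : p ≠ 0 := fun h0 => by
    rw [h0, zero_cpow hα0] at h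
    exact (cpow_ne_zero_iff_of_exponent_ne_zero hα0).mpr I_ne_zero h.symm
  rw [cpow_def_of_ne_zero hp0, cpow_def_of_ne_zero I_ne_zero, exp_eq_exp_iff_exists_int] at h
  obtain ⟨n, hn⟩ := h
  have him := congrArg im hn
  rw [log_I] at him
  simp [log_im] at him
  have harg := abs_le.mp (abs_arg_le_pi_div_two_iff.mpr hp)
  have hpi := Real.pi_pos
  have hn0 : n = 0 := by
    have h1 : (n : ℝ) < 1 := by
      by_contra! h
      nlinarith
    have h2 : (-1 : ℝ) < n := by
      by_contra! h
      nlinarith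
    have h1' : n < 1 := by exact_mod_cast h1
    have h2' : -1 < n := by exact_mod_cast h2
    omega
  have hlogp : log p = log I := by
    rw [hn0, Int.cast_zero, zero_mul, add_zero] at hn
    exact mul_right_cancel₀ hα0 hn
  rw [← exp_log hp0, hlogp, exp_log I_ne_zero]

open Topology in
/-- The Laplace transform of `E_α(i^α t^α) - exp(i t) / α` extends continuously to the
imaginary axis. -/
theorem exists_continuousOn_cpow_sub_div {α : ℝ} (hα₁ : 1 < α) (hα₂ : α < 2) :
    ∃ l : ℂ → ℂ, ContinuousOn l {p | 0 ≤ p.re} ∧ DifferentiableOn ℂ l {p | 0 < p.re} ∧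
      ∀ p : ℂ, 0 ≤ p.re → p ≠ I → l p =
        p ^ ((α - 1 : ℝ) : ℂ) / (p ^ (α : ℂ) - I ^ (α : ℂ)) - 1 / (α * (p - I)) := by
  have hα0 : (α : ℂ) ≠ 0 := by exact_mod_cast (by linarith : α ≠ 0)
  have hslit : slitPlane ∈ 𝓝 I := isOpen_slitPlane.mem_nhds (by simp [slitPlane])
  have hsub : {p : ℂ | 0 < p.re} ⊆ slitPlane := fun p hp => Or.inl hp
  have hcpow : ∀ a : ℝ, 0 < a → ContinuousOn (fun p : ℂ => p ^ (a : ℂ)) {p | 0 ≤ p.re} :=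
    fun a ha p hp => (continuousAt_cpow_const_of_re_pos (Or.inl hp)
      (by simpa using ha)).continuousWithinAt
  have hdpow : ∀ a : ℂ, DifferentiableOn ℂ (fun p : ℂ => p ^ a) slitPlane := fun a p hp =>
    (DifferentiableAt.cpow_const differentiableAt_id hp).differentiableWithinAt
  have hdslope : ∀ f : ℂ → ℂ, ContinuousOn f {p | 0 ≤ p.re} → DifferentiableOn ℂ f slitPlane →
      ContinuousOn (dslope f I) {p | 0 ≤ p.re} ∧ DifferentiableOn ℂ (dslope f I) slitPlane := by
    intro f hf hf'
    have hd := (differentiableOn_dslope hslit).mpr hf'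
    refine ⟨fun p hp => ?_, hd⟩
    by_cases hpI : p = I
    · rw [hpI]
      exact (hd.differentiableAt hslit).continuousAt.continuousWithinAt
    · exact (continuousWithinAt_dslope_of_ne hpI).mpr (hf p hp)
  set A := dslope (fun p : ℂ => p ^ (α : ℂ)) I with hA
  obtain ⟨hAc, hAd⟩ := hdslope _ (hcpow α (by linarith)) (hdpow α)
  set B : ℂ → ℂ := fun p => α * p ^ ((α - 1 : ℝ) : ℂ) - A p with hB
  obtain ⟨hBc, hBd⟩ := hdslope B ((continuousOn_const.mul (hcpow _ (by linarith))).sub hAc)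
    (((hdpow _).const_mul _).sub hAd)
  have hAI : A I = α * I ^ ((α - 1 : ℝ) : ℂ) := by
    rw [hA, dslope_same]
    have := (hasDerivAt_id I).cpow_const (c := α) (by simp [slitPlane])
    simpa using this.deriv
  have hAne : ∀ p : ℂ, p ≠ I → A p = (p ^ (α : ℂ) - I ^ (α : ℂ)) / (p - I) := fun p hp => by
    rw [hA, dslope_of_ne _ hp, slope_def_field]
  have hA0 : ∀ p : ℂ, 0 ≤ p.re → A p ≠ 0 := fun p hp => by
    by_cases hpI : p = I
    · rw [hpI, hAI]
      refine mul_ne_zero hα0 ?_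
      rw [I_cpow]
      exact exp_ne_zero _
    · rw [hAne p hpI]
      exact div_ne_zero (sub_ne_zero.mpr fun h => hpI (eq_I_of_cpow_eq hα₁ hα₂ hp h))
        (sub_ne_zero.mpr hpI)
  refine ⟨fun p => dslope B I p / (α * A p), ?_, ?_, fun p hp hpI => ?_⟩
  · exact hBc.div (continuousOn_const.mul hAc) fun p hp => mul_ne_zero hα0 (hA0 p hp)
  · exact (hBd.mono hsub).div ((hAd.mono hsub).const_mul _) fun p hp =>
      mul_ne_zero hα0 (hA0 p (le_of_lt hp))
  · have hBI : B I = 0 := by simp [hB, hAI]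
    have h1 : p - I ≠ 0 := sub_ne_zero.mpr hpI
    have h2 : p ^ (α : ℂ) - I ^ (α : ℂ) ≠ 0 :=
      sub_ne_zero.mpr fun h => hpI (eq_I_of_cpow_eq hα₁ hα₂ hp h)
    simp only [dslope_of_ne _ hpI, slope_def_field, hBI]
    simp only [hB, hAne p hpI]
    field_simp
    ring

end Complex

namespace Complex

open Topology in
theorem tendsto_mul_cpow_sub_div {α : ℝ} (hα : 0 < α) {l : ℂ → ℂ}
    (hl : ∀ p : ℂ, 0 ≤ p.re → p ≠ I → l p =
      p ^ ((α - 1 : ℝ) : ℂ) / (p ^ (α : ℂ) - I ^ (α : ℂ)) - 1 / (α * (p - I))) :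
    Tendsto (fun p => p * l p) (Bornology.cobounded ℂ ⊓ 𝓟 {p | 0 ≤ p.re})
      (𝓝 (1 - 1 / α)) := by
  have hpow : Tendsto (fun p : ℂ => p ^ (α : ℂ)) (Bornology.cobounded ℂ) (Bornology.cobounded ℂ) := by
    rw [← tendsto_norm_atTop_iff_cobounded]
    simp only [norm_cpow_real]
    exact (tendsto_rpow_atTop hα).comp tendsto_norm_cobounded_atTop
  have hinv := tendsto_inv₀_cobounded (α := ℂ)
  have h1 : Tendsto (fun p : ℂ => 1 / (1 - I ^ (α : ℂ) * (p ^ (α : ℂ))⁻¹) -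
      1 / (α * (1 - I * p⁻¹))) (Bornology.cobounded ℂ) (𝓝 (1 - 1 / α)) := by
    have h2 := ((hinv.comp hpow).const_mul (I ^ (α : ℂ))).const_sub 1
    have h3 := ((hinv.const_mul I).const_sub 1).const_mul (α : ℂ)
    have hα0 : (α : ℂ) ≠ 0 := by exact_mod_cast hα.ne'
    rw [mul_zero, sub_zero] at h2 h3
    rw [mul_one] at h3
    have := (tendsto_const_nhds (x := (1 : ℂ))).div h2 one_ne_zero |>.sub
      ((tendsto_const_nhds (x := (1 : ℂ))).div h3 hα0)
    simpa using this
  refine (h1.mono_left inf_le_left).congr' ?_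
  filter_upwards [(Bornology.eventually_ne_cobounded (0 : ℂ)).filter_mono inf_le_left,
    (Bornology.eventually_ne_cobounded I).filter_mono inf_le_left,
    mem_inf_of_right (mem_principal_self {p : ℂ | 0 ≤ p.re})] with p hp0 hpI hp
  have hpow0 : p ^ (α : ℂ) ≠ 0 :=
    (cpow_ne_zero_iff_of_exponent_ne_zero (by exact_mod_cast hα.ne')).mpr hp0
  have hI : p - I ≠ 0 := sub_ne_zero.mpr hpI
  rw [hl p hp hpI, ofReal_sub, ofReal_one, cpow_sub _ _ hp0, cpow_one, mul_sub p]
  have e1 : 1 - I ^ (α : ℂ) * (p ^ (α : ℂ))⁻¹ = (p ^ (α : ℂ) - I ^ (α : ℂ)) / p ^ (α : ℂ) := by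
    field_simp
  have e2 : 1 - I * p⁻¹ = (p - I) / p := by field_simp
  rw [e1, e2]
  congr 1
  · rw [one_div_div]; field_simp
  · field_simp

theorem re_cpow_sub_div_of_pos {α : ℝ} {x : ℝ} (hx : 0 < x) :
    (((x : ℂ) * I) ^ ((α - 1 : ℝ) : ℂ) / (((x : ℂ) * I) ^ (α : ℂ) - I ^ (α : ℂ)) -
      1 / (α * (x * I - I))).re = 0 := by
  have hI : I ^ (α : ℂ) ≠ 0 := by rw [I_cpow]; exact exp_ne_zero _
  have hx0 : (x : ℂ) * I ≠ 0 := mul_ne_zero (by exact_mod_cast hx.ne') I_ne_zero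
  rw [ofReal_sub, ofReal_one, cpow_sub _ _ hx0, cpow_one, ofReal_mul_cpow hx I_ne_zero]
  generalize x ^ α = v
  have : (v : ℂ) * I ^ (α : ℂ) / (x * I) / (v * I ^ (α : ℂ) - I ^ (α : ℂ)) -
      1 / (α * (x * I - I)) = ((v / x / (v - 1) - 1 / (α * (x - 1)) : ℝ) : ℂ) * I⁻¹ := by
    rw [show (v : ℂ) * I ^ (α : ℂ) - I ^ (α : ℂ) = I ^ (α : ℂ) * (v - 1) by ring,
      show (α : ℂ) * (x * I - I) = I * (α * (x - 1)) by ring, div_div,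
      show (x : ℂ) * I * (I ^ (α : ℂ) * (v - 1)) = I ^ (α : ℂ) * (x * (v - 1) * I) by ring,
      mul_comm, mul_div_mul_left _ _ hI]
    push_cast
    simp only [div_eq_mul_inv, mul_inv]
    ring
  rw [this, re_ofReal_mul]
  simp

theorem re_cpow_sub_div_of_neg {α : ℝ} {u : ℝ} (hu : 0 < u) :
    (((-u : ℝ) * I : ℂ) ^ ((α - 1 : ℝ) : ℂ) / (((-u : ℝ) * I : ℂ) ^ (α : ℂ) - I ^ (α : ℂ)) -
      1 / (α * ((-u : ℝ) * I - I))).re =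
    -Real.sin (Real.pi * α) * u ^ α /
      (u * ((u ^ α - Real.cos (Real.pi * α)) ^ 2 + Real.sin (Real.pi * α) ^ 2)) := by
  have hnI : -I ≠ 0 := neg_ne_zero.mpr I_ne_zero
  have hu0 : (u : ℂ) * -I ≠ 0 := mul_ne_zero (by exact_mod_cast hu.ne') hnI
  have e : ((-u : ℝ) * I : ℂ) = u * -I := by push_cast; ring
  rw [e, ofReal_sub, ofReal_one, cpow_sub _ _ hu0, cpow_one, ofReal_mul_cpow hu hnI]
  set v := u ^ α
  have hz : I ^ (α : ℂ) = (-I) ^ (α : ℂ) * exp ((Real.pi * α : ℝ) * I) := by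
    rw [I_cpow, neg_I_cpow, ← exp_add]
    congr 1
    push_cast
    ring
  have hne : (-I) ^ (α : ℂ) ≠ 0 := by rw [neg_I_cpow]; exact exp_ne_zero _
  have e1 : (v : ℂ) * (-I) ^ (α : ℂ) / (u * -I) / (v * (-I) ^ (α : ℂ) - I ^ (α : ℂ)) =
      ((v / u : ℝ) : ℂ) * (I * (v - exp ((Real.pi * α : ℝ) * I))⁻¹) := by
    rw [hz, show (v : ℂ) * (-I) ^ (α : ℂ) - (-I) ^ (α : ℂ) * exp ((Real.pi * α : ℝ) * I) =
      (-I) ^ (α : ℂ) * (v - exp ((Real.pi * α : ℝ) * I)) by ring, div_div,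
      show (u : ℂ) * -I * ((-I) ^ (α : ℂ) * (v - exp ((Real.pi * α : ℝ) * I))) =
      (-I) ^ (α : ℂ) * (u * -I * (v - exp ((Real.pi * α : ℝ) * I))) by ring, mul_comm,
      mul_div_mul_left _ _ hne]
    push_cast
    simp only [div_eq_mul_inv, mul_inv, inv_neg, inv_I, neg_neg]
    ring
  have e2 : (1 : ℂ) / (α * (u * -I - I)) = ((1 / (α * (u + 1)) : ℝ) : ℂ) * I := by
    rw [show (α : ℂ) * (u * -I - I) = -I * (α * (u + 1) : ℝ) by push_cast; ring]
    push_cast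
    simp only [div_eq_mul_inv, mul_inv, inv_neg, inv_I, neg_neg]
    ring
  rw [e1, e2, sub_re, re_ofReal_mul, I_mul_re, inv_im, re_ofReal_mul, I_re, mul_zero, sub_zero,
    normSq_apply]
  simp only [sub_re, sub_im, ofReal_re, ofReal_im, exp_ofReal_mul_I_re, exp_ofReal_mul_I_im]
  simp only [div_eq_mul_inv, mul_inv, zero_sub, neg_neg, pow_two, neg_mul_neg]
  ring

theorem spectral_density_nonneg {α u : ℝ} (hα₁ : 1 < α) (hα₂ : α < 2) (hu : 0 < u) :
    0 ≤ -Real.sin (Real.pi * α) * u ^ α /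
      (u * ((u ^ α - Real.cos (Real.pi * α)) ^ 2 + Real.sin (Real.pi * α) ^ 2)) := by
  have hs : Real.sin (Real.pi * α) < 0 := by
    have := Real.sin_pos_of_pos_of_lt_pi (x := Real.pi * α - Real.pi)
      (by nlinarith [Real.pi_pos]) (by nlinarith [Real.pi_pos])
    rw [Real.sin_sub_pi] at this
    linarith
  have : 0 < -Real.sin (Real.pi * α) := by linarith
  positivity

theorem spectral_density_le {α u : ℝ} (hα₁ : 1 < α) (hα₂ : α < 2) (hu : 0 < u) :
    (1 + u ^ 2) * (-Real.sin (Real.pi * α) * u ^ α /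
      (u * ((u ^ α - Real.cos (Real.pi * α)) ^ 2 + Real.sin (Real.pi * α) ^ 2))) ≤
      2 / -Real.sin (Real.pi * α) := by
  have hs : 0 < -Real.sin (Real.pi * α) := by
    have := Real.sin_pos_of_pos_of_lt_pi (x := Real.pi * α - Real.pi)
      (by nlinarith [Real.pi_pos]) (by nlinarith [Real.pi_pos])
    rwa [Real.sin_sub_pi] at this
  have hv : 0 < u ^ α := by positivity
  have hsc := Real.sin_sq_add_cos_sq (Real.pi * α)
  have hle : u ≤ 1 → u ^ α ≤ u := fun h => by
    simpa using Real.rpow_le_rpow_of_exponent_ge hu h hα₁.le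
  have hge : 1 ≤ u → u ≤ u ^ α := fun h => by
    simpa using Real.rpow_le_rpow_of_exponent_le h hα₁.le
  generalize u ^ α = v at *
  set s := -Real.sin (Real.pi * α) with hsdef
  have hs2 : Real.sin (Real.pi * α) ^ 2 = s ^ 2 := by rw [hsdef]; ring
  rw [hs2] at hsc ⊢
  set c := Real.cos (Real.pi * α)
  rw [← mul_div_assoc, div_le_div_iff₀ (by positivity) hs]
  have hD1 : s ^ 2 ≤ (v - c) ^ 2 + s ^ 2 := by nlinarith [sq_nonneg (v - c)]
  have hD2 : s ^ 2 * v ^ 2 ≤ (v - c) ^ 2 + s ^ 2 := by nlinarith [sq_nonneg (1 - v * c)]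
  rcases le_total u 1 with h | h
  · have h1 := hle h
    calc (1 + u ^ 2) * (s * v) * s = (1 + u ^ 2) * v * s ^ 2 := by ring
      _ ≤ 2 * u * s ^ 2 := by
        gcongr
        nlinarith
      _ ≤ 2 * u * ((v - c) ^ 2 + s ^ 2) := by gcongr
      _ = _ := by ring
  · have h1 := hge h
    calc (1 + u ^ 2) * (s * v) * s = (1 + u ^ 2) * v * s ^ 2 := by ring
      _ ≤ (2 * u * v) * v * s ^ 2 := by
        gcongr
        nlinarith
      _ = 2 * u * (s ^ 2 * v ^ 2) := by ring
      _ ≤ 2 * u * ((v - c) ^ 2 + s ^ 2) := by gcongr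
      _ = _ := by ring

theorem exists_finite_measure_cpow_sub_div {α : ℝ} (hα₁ : 1 < α) (hα₂ : α < 2) :
    ∃ ν : Measure ℝ, IsFiniteMeasure ν ∧ ∀ p : ℂ, 0 < p.re →
      p ^ ((α - 1 : ℝ) : ℂ) / (p ^ (α : ℂ) - I ^ (α : ℂ)) - 1 / (α * (p - I)) =
        ∫ x : ℝ, 1 / (p - x * I) ∂ν := by
  obtain ⟨l, hc, hd, hl⟩ := exists_continuousOn_cpow_sub_div hα₁ hα₂
  have hcI : Continuous fun x : ℝ => (l (x * I)).re :=
    continuous_re.comp (hc.comp_continuous (by fun_prop) (by simp))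
  have hs : 0 < 2 / -Real.sin (Real.pi * α) := by
    have := Real.sin_pos_of_pos_of_lt_pi (x := Real.pi * α - Real.pi)
      (by nlinarith [Real.pi_pos]) (by nlinarith [Real.pi_pos])
    rw [Real.sin_sub_pi] at this
    positivity
  have hdense : Dense ({0, 1}ᶜ : Set ℝ) := (Set.toFinite {0, 1}).countable.dense_compl ℝ
  have hkey : ∀ x ∈ ({0, 1}ᶜ : Set ℝ), 0 ≤ (l (x * I)).re ∧
      (1 + x ^ 2) * (l (x * I)).re ≤ 2 / -Real.sin (Real.pi * α) := by
    intro x hx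
    simp only [mem_compl_iff, mem_insert_iff, mem_singleton_iff, not_or] at hx
    have hxI : (x : ℂ) * I ≠ I := fun h => hx.2 (by simpa using h)
    rw [hl _ (by simp) hxI]
    rcases lt_or_gt_of_ne hx.1 with h | h
    · obtain ⟨u, rfl⟩ : ∃ u, x = -u := ⟨-x, by ring⟩
      have hu : 0 < u := by linarith
      rw [re_cpow_sub_div_of_neg hu, neg_sq]
      exact ⟨spectral_density_nonneg hα₁ hα₂ hu, spectral_density_le hα₁ hα₂ hu⟩
    · rw [re_cpow_sub_div_of_pos h]
      simpa using hs.le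
  obtain ⟨ν, hν, hrep⟩ := exists_finite_measure_cauchy_transform
    (C := 2 / -Real.sin (Real.pi * α)) hc hd
    (tendsto_mul_cpow_sub_div (by linarith) hl)
    (fun x => (isClosed_le continuous_const hcI).closure_subset_iff.mpr
      (fun y hy => (hkey y hy).1) (hdense x))
    (fun x => (isClosed_le (f := fun x : ℝ => (1 + x ^ 2) * (l (x * I)).re)
      (g := fun _ => 2 / -Real.sin (Real.pi * α)) (by fun_prop) continuous_const).closure_subset_iff.mpr (fun y hy => (hkey y hy).2) (hdense x))
  refine ⟨ν, hν, fun p hp => ?_⟩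
  rw [← hrep p hp, hl p hp.le]
  rintro rfl
  simp at hp

end Complex

open Complex ProbabilityTheory Topology in
theorem integral_rpow_mul_cexp_neg_mul_Ioi {a : ℝ} (ha : 0 < a) {p : ℂ} (hp : 0 < p.re) :
    ∫ t in Ioi (0 : ℝ), ((t ^ (a - 1) : ℝ) : ℂ) * exp (-(p * t)) =
      Real.Gamma a / p ^ (a : ℂ) := by
  set μ : Measure ℝ := (volume.restrict (Ioi 0)).withDensity (fun t => ENNReal.ofReal (t ^ (a - 1)))
  have hm : Measurable fun t : ℝ => ENNReal.ofReal (t ^ (a - 1)) := by fun_prop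
  have hμ : ∀ z : ℂ, complexMGF (fun t : ℝ => -t) μ z =
      ∫ t in Ioi (0 : ℝ), ((t ^ (a - 1) : ℝ) : ℂ) * exp (-(z * t)) := fun z => by
    rw [complexMGF, integral_withDensity_eq_integral_toReal_smul hm
      (ae_of_all _ fun _ => ENNReal.ofReal_lt_top)]
    refine setIntegral_congr_fun measurableSet_Ioi fun t ht => ?_
    rw [ENNReal.toReal_ofReal (Real.rpow_nonneg (le_of_lt ht) _), real_smul]
    push_cast
    ring_nf
  have hset : Ioi 0 ⊆ integrableExpSet (fun t : ℝ => -t) μ := fun r hr => by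
    change Integrable _ _
    rw [integrable_withDensity_iff_integrable_smul' hm
      (ae_of_all _ fun _ => ENNReal.ofReal_lt_top)]
    have := integrableOn_rpow_mul_exp_neg_mul_rpow (p := 1) (s := a - 1) (b := r)
      (by linarith) one_pos hr
    refine (integrableOn_congr_fun (fun t ht => ?_) measurableSet_Ioi).mp this
    simp only
    rw [ENNReal.toReal_ofReal (Real.rpow_nonneg (le_of_lt ht) _), smul_eq_mul, Real.rpow_one]
    ring_nf
  have hU : IsOpen {z : ℂ | 0 < z.re} := isOpen_lt continuous_const continuous_re
  have han : AnalyticOnNhd ℂ (complexMGF (fun t : ℝ => -t) μ) {z | 0 < z.re} :=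
    (differentiableOn_complexMGF.mono fun z hz =>
      interior_mono hset (by rwa [isOpen_Ioi.interior_eq])).analyticOnNhd hU
  have han' : AnalyticOnNhd ℂ (fun z : ℂ => Real.Gamma a / z ^ (a : ℂ)) {z | 0 < z.re} := by
    refine DifferentiableOn.analyticOnNhd (fun z hz => ?_) hU
    have hz0 : z ≠ 0 := by rintro rfl; simp at hz
    refine (DifferentiableAt.div (by fun_prop) (differentiableAt_id.cpow_const (Or.inl hz))
      ?_).differentiableWithinAt
    exact (cpow_ne_zero_iff_of_exponent_ne_zero (by exact_mod_cast ha.ne')).mpr hz0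
  have hreal : ∀ r : ℝ, 0 < r →
      complexMGF (fun t : ℝ => -t) μ r = Real.Gamma a / (r : ℂ) ^ (a : ℂ) := fun r hr => by
    rw [hμ]
    have h := integral_cpow_mul_exp_neg_mul_Ioi (a := (a : ℂ)) (by simpa using ha) hr
    rw [one_div, inv_cpow _ _ (by rw [arg_ofReal_of_nonneg hr.le]; exact Real.pi_ne_zero.symm),
      Gamma_ofReal, ← div_eq_inv_mul] at h
    rw [← h]
    refine setIntegral_congr_fun measurableSet_Ioi fun t ht => ?_
    rw [ofReal_cpow (le_of_lt ht)]
    push_cast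
    rfl
  have hfreq : ∃ᶠ z : ℂ in 𝓝[≠] 1, complexMGF (fun t : ℝ => -t) μ z = Real.Gamma a / z ^ (a : ℂ) := by
    have htend : Tendsto ((↑) : ℝ → ℂ) (𝓝[≠] 1) (𝓝[≠] 1) := by
      refine tendsto_nhdsWithin_iff.mpr ⟨?_, ?_⟩
      · exact (continuous_ofReal.tendsto' 1 1 (by simp)).mono_left nhdsWithin_le_nhds
      · filter_upwards [self_mem_nhdsWithin] with x hx
        simpa using hx
    refine htend.frequently (Eventually.frequently ?_)
    filter_upwards [nhdsWithin_le_nhds (isOpen_Ioi.mem_nhds (zero_lt_one (α := ℝ)))] with r hr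
    exact hreal r hr
  have hconv : IsPreconnected {z : ℂ | 0 < z.re} := (convex_halfSpace_re_gt 0).isPreconnected
  rw [← hμ]
  exact han.eqOn_of_preconnected_of_frequently_eq han' hconv (by simp) hfreq hp

theorem integrable_tsum_of_summable_integral_norm {X E : Type*} [MeasurableSpace X]
    [NormedAddCommGroup E] {μ : Measure X} {F : ℕ → X → E} (hF : ∀ i, Integrable (F i) μ)
    (hsum : Summable fun i => ∫ x, ‖F i x‖ ∂μ)
    (hm : AEStronglyMeasurable (fun x => ∑' i, F i x) μ) :
    Integrable (fun x => ∑' i, F i x) μ := by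
  refine ⟨hm, ?_⟩
  calc ∫⁻ x, ‖∑' i, F i x‖ₑ ∂μ ≤ ∫⁻ x, ∑' i, ‖F i x‖ₑ ∂μ :=
        lintegral_mono fun x => enorm_tsum_le_tsum_enorm
    _ = ∑' i, ∫⁻ x, ‖F i x‖ₑ ∂μ := lintegral_tsum fun i => (hF i).1.enorm
    _ = ∑' i, ENNReal.ofReal (∫ x, ‖F i x‖ ∂μ) := by
        simp_rw [ofReal_integral_norm_eq_lintegral_enorm (hF _)]
    _ < ⊤ := by
        rw [← ENNReal.ofReal_tsum_of_nonneg (fun i => integral_nonneg fun x => norm_nonneg _) hsum]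
        exact ENNReal.ofReal_lt_top

open Complex in
/-- A continuous function on the half-line whose Laplace transform vanishes on a vertical line
is zero. -/
theorem eq_zero_of_laplace_eq_zero {f : ℝ → ℂ} (hf : Continuous f) {σ : ℝ}
    (hint : IntegrableOn (fun t : ℝ => f t * exp (-(σ * t))) (Ioi 0))
    (hzero : ∀ p : ℂ, p.re = σ → ∫ t in Ioi (0 : ℝ), f t * exp (-(p * t)) = 0)
    {t : ℝ} (ht : 0 < t) : f t = 0 := by
  set g : ℝ → ℂ := (Ioi 0).indicator fun t => f t * exp (-(σ * t)) with hg
  have hgi : Integrable g := (integrable_indicator_iff measurableSet_Ioi).mpr hint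
  have hF : FourierTransform.fourier g = fun _ : ℝ => (0 : ℂ) := by
    ext w
    rw [Real.fourier_real_eq_integral_exp_smul, ← hzero (σ + 2 * Real.pi * w * I) (by simp),
      ← integral_indicator measurableSet_Ioi]
    congr 1
    ext x
    by_cases hx : x ∈ Ioi (0 : ℝ)
    · simp only [hg, indicator_of_mem hx, smul_eq_mul]
      rw [mul_left_comm, ← exp_add]
      congr 2
      push_cast
      ring
    · simp only [hg, indicator_of_notMem hx, smul_zero]
  have hcont : ContinuousAt g t := by
    have : ContinuousAt (fun t : ℝ => f t * exp (-(σ * t))) t := by fun_prop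
    refine this.congr ?_
    filter_upwards [isOpen_Ioi.mem_nhds ht] with x hx
    rw [hg, indicator_of_mem hx]
  have hinv := hgi.fourierInv_fourier_eq (by rw [hF]; exact integrable_zero _ _ _) hcont
  rw [hF, Real.fourierInv_eq'] at hinv
  simp only [smul_zero, integral_zero] at hinv
  have ht' : t ∈ Ioi (0 : ℝ) := ht
  rw [hg, indicator_of_mem ht'] at hinv
  exact (mul_eq_zero.mp hinv.symm).resolve_right (exp_ne_zero _)

open Complex in
theorem integrable_prod_charFun_laplace (ν : Measure ℝ) [IsFiniteMeasure ν] {p : ℂ}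
    (hp : 0 < p.re) :
    Integrable (Function.uncurry fun t x : ℝ => exp (t * x * I) * exp (-(p * t)))
      ((volume.restrict (Ioi 0)).prod ν) := by
  have h := (exp_neg_integrableOn_Ioi 0 hp).mul_prod (integrable_const (μ := ν) (1 : ℝ))
  refine h.mono' ?_ (ae_of_all _ fun z => ?_)
  · exact Continuous.aestronglyMeasurable (by unfold Function.uncurry; fun_prop)
  · simp [Function.uncurry, norm_exp]

open Complex in
theorem integral_charFun_mul_exp (ν : Measure ℝ) [IsFiniteMeasure ν] {p : ℂ} (hp : 0 < p.re) :
    ∫ t in Ioi (0 : ℝ), charFun ν t * exp (-(p * t)) = ∫ x : ℝ, 1 / (p - x * I) ∂ν := by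
  simp_rw [charFun_apply_real, ← integral_mul_const]
  rw [integral_integral_swap (integrable_prod_charFun_laplace ν hp)]
  congr 1
  ext x
  have h := integral_exp_mul_complex_Ioi (a := x * I - p) (by simpa using hp) 0
  simp only [ofReal_zero, mul_zero, exp_zero] at h
  rw [← neg_sub p, neg_div_neg_eq] at h
  rw [← h]
  congr 1
  ext t
  rw [← exp_add]
  ring_nf

open Complex in
theorem integrableOn_charFun_mul_exp (ν : Measure ℝ) [IsFiniteMeasure ν] {p : ℂ}
    (hp : 0 < p.re) : IntegrableOn (fun t : ℝ => charFun ν t * exp (-(p * t))) (Ioi 0) := by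
  simp_rw [charFun_apply_real, ← integral_mul_const]
  exact (integrable_prod_charFun_laplace ν hp).integral_prod_left

theorem one_div_Gamma_mul_add_one_le {α : ℝ} (hα : 1 < α) (k : ℕ) :
    1 / Real.Gamma (α * k + 1) ≤ 1 / k.factorial := by
  rw [← Real.Gamma_nat_eq_factorial]
  rcases k.eq_zero_or_pos with rfl | hk
  · simp
  have hk' : (1 : ℝ) ≤ k := by exact_mod_cast hk
  have hle : (k : ℝ) + 1 ≤ α * k + 1 := by nlinarith
  refine one_div_le_one_div_of_le (Real.Gamma_pos_of_pos (by positivity)) ?_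
  have h₁ : (k : ℝ) + 1 ∈ Ici (2 : ℝ) := mem_Ici.mpr (by linarith)
  have h₂ : α * k + 1 ∈ Ici (2 : ℝ) := mem_Ici.mpr (by linarith)
  exact Real.Gamma_strictMonoOn_Ici.monotoneOn h₁ h₂ hle

theorem continuous_mittagLeffler_one {α : ℝ} (hα : 1 < α) : Continuous (mittagLeffler α 1) := by
  have hball : ∀ R : ℝ, ContinuousOn (mittagLeffler α 1) (Metric.ball 0 R) := fun R => by
    unfold mittagLeffler
    refine continuousOn_tsum (fun k => ?_) (Real.summable_pow_div_factorial R) fun k z hz => ?_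
    · exact ((continuous_pow k).div_const _).continuousOn
    have hz' : ‖z‖ ≤ R := (mem_ball_zero_iff.mp hz).le
    have hG : 0 < Real.Gamma (α * k + 1) := Real.Gamma_pos_of_pos (by positivity)
    rw [norm_div, norm_pow, Complex.norm_real, Real.norm_of_nonneg hG.le, div_eq_mul_one_div,
      div_eq_mul_one_div (R ^ k)]
    exact mul_le_mul (pow_le_pow_left₀ (norm_nonneg z) hz' k)
      (one_div_Gamma_mul_add_one_le hα k) (by positivity)
      (pow_nonneg ((norm_nonneg z).trans hz') k)
  refine continuous_iff_continuousAt.mpr fun z => ?_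
  exact (hball (‖z‖ + 1)).continuousAt (Metric.isOpen_ball.mem_nhds (by simp))

theorem mittagLeffler_one_zero (α : ℝ) : mittagLeffler α 1 0 = 1 := by
  rw [mittagLeffler, tsum_eq_single 0 fun k hk => by simp [hk]]
  simp

open Complex in
theorem hasLaplace_mittagLeffler {α : ℝ} (hα : 1 < α) {ζ : ℂ} (hζ : ‖ζ‖ = 1) {p : ℂ}
    (hp : 1 < p.re) :
    IntegrableOn (fun t : ℝ => mittagLeffler α 1 ((t ^ α : ℝ) * ζ) * exp (-(p * t))) (Ioi 0) ∧
    ∫ t in Ioi (0 : ℝ), mittagLeffler α 1 ((t ^ α : ℝ) * ζ) * exp (-(p * t)) =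
      p ^ ((α - 1 : ℝ) : ℂ) / (p ^ (α : ℂ) - ζ) := by
  have hp0 : 0 < p.re := by linarith
  have hpne : p ≠ 0 := by rintro rfl; simp at hp0
  set a : ℕ → ℝ := fun k => α * k + 1 with ha_def
  have ha : ∀ k, 0 < a k := fun k => by positivity
  have hG : ∀ k, 0 < Real.Gamma (a k) := fun k => Real.Gamma_pos_of_pos (ha k)
  set F : ℕ → ℝ → ℂ := fun k t => ((t ^ α : ℝ) * ζ) ^ k / (Real.Gamma (a k) : ℂ) * exp (-(p * t))
    with hF_def
  have hF : ∀ k, ∀ t ∈ Ioi (0 : ℝ), F k t =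
      ζ ^ k / (Real.Gamma (a k) : ℂ) * (((t ^ (a k - 1) : ℝ) : ℂ) * exp (-(p * t))) :=
    fun k t ht => by
      simp only [hF_def, ha_def]
      rw [add_sub_cancel_right, Real.rpow_mul (le_of_lt ht), Real.rpow_natCast, mul_pow, ofReal_pow]
      ring
  have hFnorm : ∀ k, ∀ t ∈ Ioi (0 : ℝ), ‖F k t‖ =
      1 / Real.Gamma (a k) * (t ^ (a k - 1) * Real.exp (-(p.re * t))) := fun k t ht => by
    rw [hF k t ht, norm_mul, norm_div, norm_pow, hζ, one_pow, norm_real,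
      Real.norm_of_nonneg (hG k).le, norm_mul, norm_real,
      Real.norm_of_nonneg (Real.rpow_nonneg (le_of_lt ht) _), norm_exp]
    simp
  have hmeas : ∀ k, AEStronglyMeasurable (F k) (volume.restrict (Ioi 0)) := fun k => by
    have : Continuous fun t : ℝ => t ^ α := Real.continuous_rpow_const (by linarith)
    exact Continuous.aestronglyMeasurable (by fun_prop)
  have hFint : ∀ k, IntegrableOn (F k) (Ioi 0) := fun k => by
    refine (integrable_norm_iff (hmeas k)).mp ?_
    refine (integrableOn_congr_fun (hFnorm k) measurableSet_Ioi).mpr (Integrable.const_mul ?_ _)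
    have := integrableOn_rpow_mul_exp_neg_mul_rpow (p := 1) (s := a k - 1) (b := p.re)
      (by linarith [ha k]) one_pos hp0
    simpa [IntegrableOn] using this
  have hFnormint : ∀ k, ∫ t in Ioi (0 : ℝ), ‖F k t‖ = (1 / p.re) ^ (a k) := fun k => by
    rw [setIntegral_congr_fun measurableSet_Ioi (hFnorm k), integral_const_mul,
      Real.integral_rpow_mul_exp_neg_mul_Ioi (ha k) hp0]
    field_simp [(hG k).ne']
  have hsum : Summable fun k => ∫ t in Ioi (0 : ℝ), ‖F k t‖ := by
    have hq : (1 / p.re) ^ α < 1 :=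
      Real.rpow_lt_one (by positivity) ((div_lt_one hp0).mpr hp) (by linarith)
    have hterm : ∀ k, ∫ t in Ioi (0 : ℝ), ‖F k t‖ = ((1 / p.re) ^ α) ^ k * (1 / p.re) :=
      fun k => by
        rw [hFnormint, Real.rpow_add (by positivity), Real.rpow_mul (by positivity),
          Real.rpow_natCast, Real.rpow_one]
    simp_rw [hterm]
    exact (summable_geometric_of_lt_one (by positivity) hq).mul_right _
  have hFsum : ∀ t : ℝ, ∑' k, F k t = mittagLeffler α 1 ((t ^ α : ℝ) * ζ) * exp (-(p * t)) :=
    fun t => tsum_mul_right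
  have hcont : Continuous fun t : ℝ => mittagLeffler α 1 ((t ^ α : ℝ) * ζ) := by
    have : Continuous fun t : ℝ => t ^ α := Real.continuous_rpow_const (by linarith)
    exact (continuous_mittagLeffler_one hα).comp (by fun_prop)
  simp_rw [← hFsum]
  refine ⟨integrable_tsum_of_summable_integral_norm hFint hsum ?_, ?_⟩
  · simp_rw [hFsum]
    exact Continuous.aestronglyMeasurable (by fun_prop)
  have hcα : p ^ (α : ℂ) ≠ 0 :=
    (cpow_ne_zero_iff_of_exponent_ne_zero (by exact_mod_cast (by linarith : α ≠ 0))).mpr hpne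
  have hnorm : 1 < ‖p ^ (α : ℂ)‖ := by
    rw [norm_cpow_real]
    exact Real.one_lt_rpow (hp.trans_le (re_le_norm p)) (by linarith)
  have hval : ∀ k, ∫ t in Ioi (0 : ℝ), F k t = (ζ / p ^ (α : ℂ)) ^ k * (1 / p) := fun k => by
    rw [setIntegral_congr_fun measurableSet_Ioi (hF k), integral_const_mul,
      integral_rpow_mul_cexp_neg_mul_Ioi (ha k) hp0]
    have hGk : (Real.Gamma (a k) : ℂ) ≠ 0 := by exact_mod_cast (hG k).ne'
    have hpow : p ^ ((a k : ℝ) : ℂ) = (p ^ (α : ℂ)) ^ k * p := by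
      simp only [ha_def]
      push_cast
      rw [cpow_add _ _ hpne, cpow_one, mul_comm (α : ℂ), cpow_nat_mul]
    rw [hpow, div_pow]
    field_simp
  rw [← (hasSum_integral_of_summable_integral_norm hFint hsum).tsum_eq]
  simp_rw [hval]
  have hlt : ‖ζ / p ^ (α : ℂ)‖ < 1 := by
    rw [norm_div, hζ]
    exact (div_lt_one (by linarith)).mpr hnorm
  have hne : p ^ (α : ℂ) - ζ ≠ 0 := fun h => by
    rw [sub_eq_zero.mp h, hζ] at hnorm
    exact lt_irrefl _ hnorm
  rw [tsum_mul_right, tsum_geometric_of_norm_lt_one hlt, one_sub_div hcα, inv_div]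
  push_cast
  rw [cpow_sub _ _ hpne, cpow_one]
  field_simp

open Complex in
theorem hasLaplace_exp_mul_I {p : ℂ} (hp : 0 < p.re) :
    IntegrableOn (fun t : ℝ => exp (t * I) * exp (-(p * t))) (Ioi 0) ∧
    ∫ t in Ioi (0 : ℝ), exp (t * I) * exp (-(p * t)) = 1 / (p - I) := by
  have hre : (I - p).re < 0 := by simpa using hp
  have heq : ∀ t : ℝ, exp (t * I) * exp (-(p * t)) = exp ((I - p) * t) := fun t => by
    rw [← exp_add]
    ring_nf
  simp_rw [heq]
  refine ⟨integrableOn_exp_mul_complex_Ioi hre 0, ?_⟩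
  rw [integral_exp_mul_complex_Ioi hre 0, ofReal_zero, mul_zero, exp_zero, ← neg_sub p,
    neg_div_neg_eq]

open Complex in
theorem exists_finite_measure_charFun_eq {α : ℝ} (hα₁ : 1 < α) (hα₂ : α < 2) :
    ∃ ν : Measure ℝ, IsFiniteMeasure ν ∧ ∀ t : ℝ, 0 < t →
      charFun ν t = mittagLeffler α 1 ((t ^ α : ℝ) * I ^ (α : ℂ)) - exp (t * I) / α := by
  obtain ⟨ν, hν, hℓ⟩ := exists_finite_measure_cpow_sub_div hα₁ hα₂
  refine ⟨ν, hν, fun t ht => ?_⟩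
  have hζ : ‖I ^ (α : ℂ)‖ = 1 := by rw [norm_cpow_real]; simp
  have hrpow : Continuous fun t : ℝ => t ^ α := Real.continuous_rpow_const (by linarith)
  have hE : Continuous fun t : ℝ => mittagLeffler α 1 ((t ^ α : ℝ) * I ^ (α : ℂ)) :=
    (continuous_mittagLeffler_one hα₁).comp (by fun_prop)
  have hφ : Continuous (charFun ν) := continuous_charFun
  set f : ℝ → ℂ := fun t =>
    mittagLeffler α 1 ((t ^ α : ℝ) * I ^ (α : ℂ)) - exp (t * I) / α - charFun ν t with hf_def
  have hsplit : ∀ (p : ℂ) (t : ℝ), f t * exp (-(p * t)) =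
      mittagLeffler α 1 ((t ^ α : ℝ) * I ^ (α : ℂ)) * exp (-(p * t)) -
        1 / α * (exp (t * I) * exp (-(p * t))) - charFun ν t * exp (-(p * t)) := fun p t => by
    simp only [hf_def]
    ring
  have hlap : ∀ p : ℂ, p.re = 2 → IntegrableOn (fun t : ℝ => f t * exp (-(p * t))) (Ioi 0) ∧
      ∫ t in Ioi (0 : ℝ), f t * exp (-(p * t)) = 0 := fun p hp => by
    obtain ⟨h₁, h₁'⟩ := hasLaplace_mittagLeffler hα₁ hζ (p := p) (by linarith)
    obtain ⟨h₂, h₂'⟩ := hasLaplace_exp_mul_I (p := p) (by linarith)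
    have h₃ := integrableOn_charFun_mul_exp ν (p := p) (by linarith)
    have h₃' := integral_charFun_mul_exp ν (p := p) (by linarith)
    have h₂c := h₂.const_mul (1 / (α : ℂ))
    have h₁₂ : IntegrableOn (fun t : ℝ =>
        mittagLeffler α 1 ((t ^ α : ℝ) * I ^ (α : ℂ)) * exp (-(p * t)) -
          1 / α * (exp (t * I) * exp (-(p * t)))) (Ioi 0) := h₁.sub h₂c
    simp_rw [hsplit]
    refine ⟨h₁₂.sub h₃, ?_⟩
    rw [integral_sub h₁₂ h₃, integral_sub h₁ h₂c, integral_const_mul, h₁', h₂', h₃',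
      ← hℓ p (by linarith)]
    rw [one_div_mul_one_div, sub_self]
  have hzero : f t = 0 := eq_zero_of_laplace_eq_zero (σ := 2) (by fun_prop)
    (hlap (2 : ℝ) (by simp)).1 (fun p hp => (hlap p hp).2) ht
  exact (sub_eq_zero.mp hzero).symm

open Complex Topology in
theorem mittagLeffler_mul_I_cpow_ne_zero {α : ℝ} (hα₁ : 1 < α) (hα₂ : α < 2) {t : ℝ}
    (ht : 0 < t) : mittagLeffler α 1 ((t ^ α : ℝ) * I ^ (α : ℂ)) ≠ 0 := by
  intro h0
  obtain ⟨ν, hν, hφ⟩ := exists_finite_measure_charFun_eq hα₁ hα₂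
  have hrpow : Continuous fun t : ℝ => t ^ α := Real.continuous_rpow_const (by linarith)
  have hE : Continuous fun t : ℝ => mittagLeffler α 1 ((t ^ α : ℝ) * I ^ (α : ℂ)) :=
    (continuous_mittagLeffler_one hα₁).comp (by fun_prop)
  have hF : Continuous fun t : ℝ =>
      mittagLeffler α 1 ((t ^ α : ℝ) * I ^ (α : ℂ)) - exp (t * I) / α := by fun_prop
  have hzero : charFun ν 0 = 1 - 1 / α := by
    have h₁ : Tendsto (charFun ν) (𝓝[>] 0) (𝓝 (charFun ν 0)) :=
      (continuous_charFun.tendsto 0).mono_left nhdsWithin_le_nhds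
    have h₂ := (hF.tendsto 0).mono_left (nhdsWithin_le_nhds (s := Ioi 0))
    rw [Real.zero_rpow (by linarith), ofReal_zero, zero_mul, zero_mul, exp_zero,
      mittagLeffler_one_zero] at h₂
    refine tendsto_nhds_unique h₁ (h₂.congr' ?_)
    filter_upwards [self_mem_nhdsWithin] with s hs
    exact (hφ s hs).symm
  have hmass : ν.real univ = 1 - 1 / α := by
    rw [charFun_zero] at hzero
    exact_mod_cast hzero
  have hle := norm_charFun_le (μ := ν) t
  rw [hφ t ht, h0, zero_sub, norm_neg, norm_div, norm_exp_ofReal_mul_I, norm_real,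
    Real.norm_of_nonneg (by linarith), hmass, div_le_iff₀ (by linarith), sub_mul,
    div_mul_cancel₀ _ (by linarith)] at hle
  linarith

/-- For `1 < α < 2`, the Mittag-Leffler function `E_α` has no zeros on the ray
`arg z = πα/2`. -/
theorem mittagLeffler_ne_zero_on_ray (α : ℝ) (hα₁ : 1 < α) (hα₂ : α < 2) :
    ∀ r : ℝ, 0 < r →
      mittagLeffler α 1 ((r : ℂ) * Complex.exp (Real.pi * α / 2 * Complex.I)) ≠ 0 := by
  intro r hr
  have h := mittagLeffler_mul_I_cpow_ne_zero hα₁ hα₂ (Real.rpow_pos_of_pos hr α⁻¹)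
  rwa [Real.rpow_inv_rpow hr.le (by linarith), Complex.I_cpow] at h
end
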